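/- arXiv:2004.03058 — 5 statements merged into one kernel-verified Lean document; each statement's English description precedes it below -/
import Mathlib

section
/- Let s ∈ M_m be maximal, and let p be a monic irreducible factor of s of degree d with r = mult_p(s). (a) If d ≥ δ_q(m) and r > 1, then d ≤ log₂(r/(r − 1))·(d_t(s) + 1). (b) If d ≥ δ_q(m) + 1, then d ≤ log₂((r + 1)/r)·(d_t(s) + 1) + 1. -/
open Polynomial

/-- `Φ(s)`: the number of distinct monic divisors of `s` in `F[x]`. -/
noncomputable def numDiv {F : Type} [Field F] (s : F[X]) : ℕ :=
  Set.ncard {d : F[X] | d.Monic ∧ d ∣ s}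

/-- `s` is maximal in `M_m`: `s` is monic of degree exactly `m` and `Φ(s) = Υ_m`. -/
def IsMaximal {F : Type} [Field F] (m : ℕ) (s : F[X]) : Prop :=
  s.Monic ∧ s.natDegree = m ∧
    ∀ t : F[X], t.Monic → t.natDegree ≤ m → numDiv t ≤ numDiv s

/-- `d_t(s)`: the largest degree of a monic irreducible factor of `s`. -/
noncomputable def dt {F : Type} [Field F] (s : F[X]) : ℕ :=
  sSup {d : ℕ | ∃ p : F[X], p.Monic ∧ Irreducible p ∧ p ∣ s ∧ p.natDegree = d}

/-- `I(d)`: the number of monic irreducible polynomials of degree `d` over `F`. -/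
noncomputable def numIrred (F : Type) [Field F] (d : ℕ) : ℕ :=
  Set.ncard {p : F[X] | p.Monic ∧ Irreducible p ∧ p.natDegree = d}

/-- `δ_q(m)`: the smallest positive integer `δ` such that `I(d) > ⌊log_q m⌋ + 1` for every
`d ≥ δ`. -/
noncomputable def deltaQ (F : Type) [Field F] [Fintype F] (m : ℕ) : ℕ :=
  sInf {δ : ℕ | 0 < δ ∧ ∀ d : ℕ, δ ≤ d →
    ⌊Real.logb (Fintype.card F) m⌋₊ + 1 < numIrred F d}

section Divisors

variable {F : Type} [Field F]

lemma finiteMultiplicity_of_monic {p s : F[X]} (hp : Irreducible p) (hs : s.Monic) :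
    FiniteMultiplicity p s :=
  FiniteMultiplicity.of_not_isUnit hp.not_isUnit hs.ne_zero

lemma multiplicity_mul_self {p s : F[X]} (hp : Irreducible p) (hpm : p.Monic) (hs : s.Monic) :
    multiplicity p (p * s) = multiplicity p s + 1 := by
  rw [multiplicity_mul hp.prime (finiteMultiplicity_of_monic hp (hpm.mul hs)), multiplicity_self,
    add_comm]

lemma multiplicity_mul_of_ne {p p' s : F[X]} (hp : Irreducible p) (hpm : p.Monic)
    (hp' : Irreducible p') (hpm' : p'.Monic) (hne : p ≠ p') (hs : s.Monic) :
    multiplicity p (p' * s) = multiplicity p s := by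
  rw [multiplicity_mul hp.prime (finiteMultiplicity_of_monic hp (hpm'.mul hs)),
    multiplicity_eq_zero.2, zero_add]
  intro h
  exact hne (eq_of_monic_of_associated hpm hpm' (hp.associated_of_dvd hp' h))

lemma numDiv_one : numDiv (1 : F[X]) = 1 := by
  have : {d : F[X] | d.Monic ∧ d ∣ 1} = {1} := by
    ext d
    constructor
    · rintro ⟨h, h1⟩
      exact h.eq_one_of_isUnit (isUnit_of_dvd_one h1)
    · rintro rfl
      exact ⟨monic_one, dvd_rfl⟩
  rw [numDiv, this, Set.ncard_singleton]

lemma numDiv_pow_mul {p t : F[X]} (hp : Irreducible p) (hpm : p.Monic)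
    (hpt : ¬ p ∣ t) (r : ℕ) : numDiv (p ^ r * t) = (r + 1) * numDiv t := by
  have key : {d : F[X] | d.Monic ∧ d ∣ p ^ r * t} =
      (fun x : ℕ × F[X] => p ^ x.1 * x.2) '' (Set.Iic r ×ˢ {d : F[X] | d.Monic ∧ d ∣ t}) := by
    ext d
    constructor
    · rintro ⟨hd, hdvd⟩
      obtain ⟨u, hu, hpu⟩ := (finiteMultiplicity_of_monic hp hd).exists_eq_pow_mul_and_not_dvd
      set i := multiplicity p d
      have hum : u.Monic := by
        have h : (p ^ i * u).Monic := hu ▸ hd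
        exact (hpm.pow i).of_mul_monic_left h
      refine ⟨(i, u), ⟨?_, hum, ?_⟩, hu.symm⟩
      · have h1 : p ^ i ∣ p ^ r * t := (Dvd.intro _ hu.symm).trans hdvd
        have h2 : IsCoprime (p ^ i) t := ((hp.coprime_iff_not_dvd).2 hpt).pow_left
        exact (pow_dvd_pow_iff hp.ne_zero hp.not_isUnit).1 (h2.dvd_of_dvd_mul_right h1)
      · have h1 : u ∣ p ^ r * t := (Dvd.intro_left _ hu.symm).trans hdvd
        have h2 : IsCoprime u (p ^ r) := ((hp.coprime_iff_not_dvd).2 hpu).symm.pow_right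
        exact h2.dvd_of_dvd_mul_left h1
    · rintro ⟨⟨i, u⟩, ⟨hi, hu, hut⟩, rfl⟩
      exact ⟨(hpm.pow i).mul hu, mul_dvd_mul (pow_dvd_pow p hi) hut⟩
  have hinj : Set.InjOn (fun x : ℕ × F[X] => p ^ x.1 * x.2)
      (Set.Iic r ×ˢ {d : F[X] | d.Monic ∧ d ∣ t}) := by
    have hmult : ∀ (i : ℕ) (u : F[X]), u ∣ t → multiplicity p (p ^ i * u) = i := by
      intro i u hu
      refine multiplicity_eq_of_dvd_of_not_dvd (dvd_mul_right _ _) ?_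
      rw [pow_succ, mul_dvd_mul_iff_left (pow_ne_zero _ hp.ne_zero)]
      exact fun h => hpt (h.trans hu)
    rintro ⟨i, u⟩ ⟨-, -, hu⟩ ⟨j, v⟩ ⟨-, -, hv⟩ h
    have hij : i = j := by
      rw [← hmult i u hu, ← hmult j v hv]
      exact congrArg (multiplicity p) h
    subst hij
    have := mul_left_cancel₀ (pow_ne_zero i hp.ne_zero) h
    simp only [Prod.mk.injEq, true_and]
    exact this
  rw [numDiv, key, hinj.ncard_image, Set.ncard_prod, numDiv]
  congr 1
  simp [Set.ncard_eq_toFinset_card']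

lemma numDiv_mul_irreducible {p s : F[X]} (hp : Irreducible p) (hpm : p.Monic) (hs : s.Monic) :
    numDiv (p * s) * (multiplicity p s + 1) = numDiv s * (multiplicity p s + 2) := by
  obtain ⟨t, ht, hpt⟩ := (finiteMultiplicity_of_monic hp hs).exists_eq_pow_mul_and_not_dvd
  set r := multiplicity p s
  rw [ht, ← mul_assoc, ← pow_succ', numDiv_pow_mul hp hpm hpt, numDiv_pow_mul hp hpm hpt]
  ring

/-- Multiplying by new irreducible factors doubles the number of divisors each time. -/
lemma numDiv_prod_mul_of_not_dvd {B : Finset F[X]} {u : F[X]} (hu : u.Monic)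
    (hB : ∀ p ∈ B, p.Monic ∧ Irreducible p ∧ ¬ p ∣ u) :
    numDiv ((∏ p ∈ B, p) * u) = 2 ^ B.card * numDiv u := by
  classical
  induction B using Finset.induction_on generalizing u with
  | empty => simp
  | insert b B hb ih =>
    have hb' := hB b (Finset.mem_insert_self b B)
    have h1 : numDiv (b * u) = 2 * numDiv u := by
      have := numDiv_mul_irreducible hb'.2.1 hb'.1 hu
      rw [multiplicity_eq_zero.2 hb'.2.2] at this
      lia
    rw [Finset.prod_insert hb, Finset.card_insert_of_notMem hb, mul_comm b, mul_assoc,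
      ih (hb'.1.mul hu), h1]
    · ring
    · intro p hp
      have hp' := hB p (Finset.mem_insert_of_mem hp)
      refine ⟨hp'.1, hp'.2.1, fun h => ?_⟩
      rcases hp'.2.1.prime.dvd_or_dvd h with h | h
      · have := eq_of_monic_of_associated hp'.1 hb'.1 (hp'.2.1.associated_of_dvd hb'.2.1 h)
        exact hb (this ▸ hp)
      · exact hp'.2.2 h

/-- Removing one copy of each of several irreducible factors of multiplicity at least `c`
divides the number of divisors by at most `(c + 1) / c` each time. -/
lemma exists_eq_prod_mul_of_le_multiplicity {A : Finset F[X]} {s : F[X]} {c : ℕ} (hc : 0 < c)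
    (hs : s.Monic) (hA : ∀ p ∈ A, p.Monic ∧ Irreducible p ∧ c ≤ multiplicity p s) :
    ∃ u : F[X], u.Monic ∧ s = (∏ p ∈ A, p) * u ∧
      numDiv s * c ^ A.card ≤ numDiv u * (c + 1) ^ A.card := by
  classical
  induction A using Finset.induction_on generalizing s with
  | empty => exact ⟨s, hs, by simp, by simp⟩
  | insert a A ha ih =>
    obtain ⟨ham, hai, hac⟩ := hA a (Finset.mem_insert_self a A)
    obtain ⟨v, rfl⟩ := dvd_of_multiplicity_pos (hc.trans_le hac)
    have hv : v.Monic := ham.of_mul_monic_left hs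
    obtain ⟨u, hu, hvu, hle⟩ := ih hv (fun p hp => by
      obtain ⟨hpm, hpi, hpc⟩ := hA p (Finset.mem_insert_of_mem hp)
      refine ⟨hpm, hpi, ?_⟩
      rwa [multiplicity_mul_of_ne hpi hpm hai ham (fun h => ha (h ▸ hp)) hv] at hpc)
    refine ⟨u, hu, by rw [Finset.prod_insert ha, mul_assoc, ← hvu], ?_⟩
    have h1 := numDiv_mul_irreducible hai ham hv
    rw [multiplicity_mul_self hai ham hv] at hac
    set k := multiplicity a v
    have h2 : numDiv (a * v) * c ≤ numDiv v * (c + 1) := by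
      refine Nat.le_of_mul_le_mul_right (c := k + 1) ?_ (by lia)
      calc numDiv (a * v) * c * (k + 1) = numDiv (a * v) * (k + 1) * c := by ring
        _ = numDiv v * ((k + 2) * c) := by rw [h1]; ring
        _ ≤ numDiv v * ((c + 1) * (k + 1)) := Nat.mul_le_mul_left _ (by nlinarith)
        _ = _ := by ring
    rw [Finset.card_insert_of_notMem ha]
    calc numDiv (a * v) * c ^ (A.card + 1) = (numDiv (a * v) * c) * c ^ A.card := by ring
      _ ≤ (numDiv v * (c + 1)) * c ^ A.card := Nat.mul_le_mul_right _ h2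
      _ = (numDiv v * c ^ A.card) * (c + 1) := by ring
      _ ≤ (numDiv u * (c + 1) ^ A.card) * (c + 1) := Nat.mul_le_mul_right _ hle
      _ = _ := by ring

end Divisors

section Maximal

variable {F : Type} [Field F] {m : ℕ} {s : F[X]}

lemma IsMaximal.numDiv_pos (hs : IsMaximal m s) : 0 < numDiv s := by
  have := hs.2.2 1 monic_one (by simp)
  rw [numDiv_one] at this
  lia

lemma IsMaximal.numDiv_lt (hs : IsMaximal m s) {t : F[X]} (ht : t.Monic)
    (hdeg : t.natDegree < m) : numDiv t < numDiv s := by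
  rcases Nat.eq_zero_or_pos (numDiv t) with h0 | h0
  · rw [h0]
    exact hs.numDiv_pos
  have h1 := numDiv_mul_irreducible irreducible_X monic_X ht
  have h2 := hs.2.2 (X * t) (monic_X.mul ht) (by rw [natDegree_X_mul ht.ne_zero]; lia)
  nlinarith

lemma IsMaximal.multiplicity_le_of_natDegree_le (hs : IsMaximal m s) {p p' : F[X]}
    (hpm : p.Monic) (hp : Irreducible p) (hpm' : p'.Monic) (hp' : Irreducible p')
    (hdeg : p'.natDegree ≤ p.natDegree) :
    multiplicity p s ≤ multiplicity p' s + 1 ∧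
      (p'.natDegree < p.natDegree → multiplicity p s ≤ multiplicity p' s) := by
  rcases Nat.eq_zero_or_pos (multiplicity p s) with h0 | h0
  · lia
  rcases eq_or_ne p' p with rfl | hne
  · simp
  obtain ⟨u, rfl⟩ := dvd_of_multiplicity_pos h0
  have hu : u.Monic := hpm.of_mul_monic_left hs.1
  rw [multiplicity_mul_self hp hpm hu, multiplicity_mul_of_ne hp' hpm' hp hpm hne hu]
  have h1 := numDiv_mul_irreducible hp hpm hu
  have h2 := numDiv_mul_irreducible hp' hpm' hu
  have hm := hs.2.1
  rw [hpm.natDegree_mul hu] at hm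
  have hdt := hpm'.natDegree_mul hu
  have hpos := hs.numDiv_pos
  set r := multiplicity p u
  set r' := multiplicity p' u
  have hu0 : 0 < numDiv u := by
    by_contra h
    have : numDiv u = 0 := by lia
    rw [this, zero_mul, mul_eq_zero] at h1
    lia
  have h3 : numDiv u * ((r' + 2) * (r + 1)) = numDiv (p' * u) * ((r' + 1) * (r + 1)) := by
    rw [← mul_assoc, ← h2]; ring
  have h4 : numDiv u * ((r + 2) * (r' + 1)) = numDiv (p * u) * ((r' + 1) * (r + 1)) := by
    rw [← mul_assoc, ← h1]; ring
  constructor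
  · have hle := hs.2.2 (p' * u) (hpm'.mul hu) (by lia)
    have : numDiv u * ((r' + 2) * (r + 1)) ≤ numDiv u * ((r + 2) * (r' + 1)) := by
      rw [h3, h4]
      exact Nat.mul_le_mul_right _ hle
    have := Nat.le_of_mul_le_mul_left this hu0
    nlinarith
  · intro hlt
    have hlt' := hs.numDiv_lt (hpm'.mul hu) (by lia)
    have : numDiv u * ((r' + 2) * (r + 1)) < numDiv u * ((r + 2) * (r' + 1)) := by
      rw [h3, h4]
      exact Nat.mul_lt_mul_of_pos_right hlt' (by positivity)
    have := Nat.lt_of_mul_lt_mul_left this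
    nlinarith

lemma bddAbove_natDegree_irreducible_factors (hs : s ≠ 0) :
    BddAbove {d : ℕ | ∃ p : F[X], p.Monic ∧ Irreducible p ∧ p ∣ s ∧ p.natDegree = d} := by
  refine ⟨s.natDegree, ?_⟩
  rintro d ⟨p, -, -, hps, rfl⟩
  exact natDegree_le_of_dvd hps hs

lemma natDegree_le_dt (hs : s ≠ 0) {p : F[X]} (hpm : p.Monic) (hp : Irreducible p) (hps : p ∣ s) :
    p.natDegree ≤ dt s :=
  le_csSup (bddAbove_natDegree_irreducible_factors hs) ⟨p, hpm, hp, hps, rfl⟩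

/-- Every monic irreducible polynomial not dividing a maximal polynomial has degree at least the
largest degree of an irreducible factor. -/
lemma IsMaximal.dt_le_natDegree (hs : IsMaximal m s) {p : F[X]} (hpm : p.Monic)
    (hp : Irreducible p) (hps : ¬ p ∣ s) : dt s ≤ p.natDegree := by
  refine csSup_le' ?_
  rintro d ⟨f, hfm, hf, hfs, rfl⟩
  by_contra! hlt
  have h1 := (hs.multiplicity_le_of_natDegree_le hfm hf hpm hp hlt.le).2 hlt
  rw [multiplicity_eq_zero.2 hps] at h1
  have := multiplicity_pos_of_dvd hfs
  lia

lemma IsMaximal.two_pow_mul_le (hs : IsMaximal m s) {A B : Finset F[X]} {c d e : ℕ} (hc : 0 < c)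
    (hA : ∀ p ∈ A, p.Monic ∧ Irreducible p ∧ p.natDegree = d ∧ c ≤ multiplicity p s)
    (hB : ∀ p ∈ B, p.Monic ∧ Irreducible p ∧ p.natDegree = e ∧ ¬ p ∣ s)
    (hcard : B.card * e ≤ A.card * d) :
    2 ^ B.card * c ^ A.card ≤ (c + 1) ^ A.card := by
  obtain ⟨u, hu, hsu, hle⟩ := exists_eq_prod_mul_of_le_multiplicity (A := A) hc hs.1
    (fun p hp => ⟨(hA p hp).1, (hA p hp).2.1, (hA p hp).2.2.2⟩)
  have hAm : (∏ p ∈ A, p).Monic := monic_prod_of_monic _ _ fun p hp => (hA p hp).1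
  have hBm : (∏ p ∈ B, p).Monic := monic_prod_of_monic _ _ fun p hp => (hB p hp).1
  have hnd := numDiv_prod_mul_of_not_dvd (B := B) hu fun p hp =>
    ⟨(hB p hp).1, (hB p hp).2.1, fun h => (hB p hp).2.2.2 (hsu ▸ h.mul_left _)⟩
  have hAd : (∏ p ∈ A, p).natDegree = A.card * d := by
    rw [natDegree_prod_of_monic _ _ fun p hp => (hA p hp).1,
      Finset.sum_congr rfl fun p hp => (hA p hp).2.2.1, Finset.sum_const, smul_eq_mul]
  have hBd : (∏ p ∈ B, p).natDegree = B.card * e := by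
    rw [natDegree_prod_of_monic _ _ fun p hp => (hB p hp).1,
      Finset.sum_congr rfl fun p hp => (hB p hp).2.2.1, Finset.sum_const, smul_eq_mul]
  have hm := hs.2.1
  rw [hsu, hAm.natDegree_mul hu, hAd] at hm
  have hmax := hs.2.2 _ (hBm.mul hu) (by rw [hBm.natDegree_mul hu, hBd]; lia)
  rw [hnd] at hmax
  have hu0 : 0 < numDiv u := by
    by_contra h
    have h0 : numDiv u = 0 := by lia
    have := Nat.mul_pos hs.numDiv_pos (pow_pos hc A.card)
    rw [h0, zero_mul] at hle
    lia
  refine Nat.le_of_mul_le_mul_left ?_ hu0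
  calc numDiv u * (2 ^ B.card * c ^ A.card) = (2 ^ B.card * numDiv u) * c ^ A.card := by ring
    _ ≤ numDiv s * c ^ A.card := Nat.mul_le_mul_right _ hmax
    _ ≤ _ := hle

end Maximal

section Counting

variable (F : Type) [Field F] [Fintype F]

lemma finite_setOf_monic_irreducible (d : ℕ) :
    {p : F[X] | p.Monic ∧ Irreducible p ∧ p.natDegree = d}.Finite := by
  have : Finite (degreeLT F (d + 1)) := Finite.of_equiv _ (degreeLTEquiv F (d + 1)).symm.toEquiv
  refine (Set.toFinite (degreeLT F (d + 1) : Set F[X])).subset ?_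
  rintro p ⟨hp, -, hd⟩
  simp only [SetLike.mem_coe, mem_degreeLT]
  rw [degree_eq_natDegree hp.ne_zero, hd]
  exact_mod_cast Nat.lt_succ_self d

variable {F}

lemma X_pow_card_pow_sub_X_dvd {n : ℕ} (hn : n ≠ 0) {a : F[X]} (ha : a ≠ 0)
    (h : ∀ p : F[X], p.Monic → Irreducible p → p.natDegree ∣ n → p ∣ a) :
    (X ^ Fintype.card F ^ n - X : F[X]) ∣ a := by
  classical
  have h0 : (X ^ Fintype.card F ^ n - X : F[X]) ≠ 0 :=
    FiniteField.X_pow_card_pow_sub_X_ne_zero F hn Fintype.one_lt_card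
  obtain ⟨c, hc⟩ := CharP.exists F
  have hsep : (X ^ Fintype.card F ^ n - X : F[X]).Separable :=
    galois_poly_separable c _ (dvd_pow
      ((CharP.cast_eq_zero_iff F c _).1 (Nat.cast_card_eq_zero F)) hn)
  refine (hsep.squarefree.isRadical.dvd_radical h0).trans ?_
  rw [UniqueFactorizationMonoid.radical_dvd_iff_primeFactors_subset ha]
  intro p hp
  rw [UniqueFactorizationMonoid.mem_primeFactors,
    UniqueFactorizationMonoid.mem_normalizedFactors_iff' h0] at hp
  rw [UniqueFactorizationMonoid.mem_primeFactors,
    UniqueFactorizationMonoid.mem_normalizedFactors_iff' ha]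
  obtain ⟨hpi, hpn, hpd⟩ := hp
  refine ⟨hpi, hpn, h p ?_ hpi ?_⟩
  · rw [← hpn]
    exact monic_normalize hpi.ne_zero
  · rw [hpi.natDegree_dvd_iff_dvd_X_pow_card_pow_sub_X, Nat.card_eq_fintype_card]
    exact hpd

/-- A nonzero polynomial of degree less than `q ^ n` misses some irreducible of degree at
most `n`. -/
lemma exists_irreducible_not_dvd {n : ℕ} (hn : n ≠ 0) {a : F[X]} (ha : a ≠ 0)
    (hdeg : a.natDegree < Fintype.card F ^ n) :
    ∃ p : F[X], p.Monic ∧ Irreducible p ∧ p.natDegree ≤ n ∧ ¬ p ∣ a := by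
  by_contra! h
  have h1 := natDegree_le_of_dvd (X_pow_card_pow_sub_X_dvd hn ha fun p hpm hp hpn =>
    h p hpm hp (Nat.le_of_dvd (Nat.pos_of_ne_zero hn) hpn)) ha
  rw [FiniteField.X_pow_card_pow_sub_X_natDegree_eq F hn Fintype.one_lt_card] at h1
  lia

lemma card_pow_le_numIrred {n : ℕ} (hn : n ≠ 0) :
    Fintype.card F ^ n ≤ n * (numIrred F n + Fintype.card F ^ (n / 2)) := by
  classical
  set q := Fintype.card F
  have hq : 1 < q := Fintype.one_lt_card
  set T := (finite_setOf_monic_irreducible F n).toFinset with hT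
  have hmem : ∀ p, p ∈ T ↔ p.Monic ∧ Irreducible p ∧ p.natDegree = n := by
    intro p; simp [hT]
  have hTcard : T.card = numIrred F n := by
    rw [numIrred, Set.ncard_eq_toFinset_card _ (finite_setOf_monic_irreducible F n)]
  set P : F[X] := ∏ p ∈ T, p
  set Q : F[X] := ∏ j ∈ Finset.Icc 1 (n / 2), (X ^ q ^ j - X)
  have hP : P.Monic := monic_prod_of_monic _ _ fun p hp => ((hmem p).1 hp).1
  have hQ0 : Q ≠ 0 := Finset.prod_ne_zero_iff.2 fun j hj =>
    FiniteField.X_pow_card_pow_sub_X_ne_zero F (by simp at hj; lia) hq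
  have hPd : P.natDegree = n * numIrred F n := by
    rw [natDegree_prod_of_monic _ _ fun p hp => ((hmem p).1 hp).1,
      Finset.sum_congr rfl fun p hp => ((hmem p).1 hp).2.2, Finset.sum_const, smul_eq_mul, hTcard,
      mul_comm]
  have hQd : Q.natDegree ≤ n * q ^ (n / 2) := by
    refine (natDegree_prod_le _ _).trans ?_
    calc ∑ j ∈ Finset.Icc 1 (n / 2), (X ^ q ^ j - X : F[X]).natDegree
        ≤ ∑ j ∈ Finset.Icc 1 (n / 2), q ^ (n / 2) := by
          refine Finset.sum_le_sum fun j hj => ?_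
          rw [Finset.mem_Icc] at hj
          rw [FiniteField.X_pow_card_pow_sub_X_natDegree_eq F (by lia) hq]
          exact Nat.pow_le_pow_right (by lia) hj.2
      _ = (n / 2) * q ^ (n / 2) := by simp
      _ ≤ n * q ^ (n / 2) := Nat.mul_le_mul_right _ (Nat.div_le_self n 2)
  have hdvd : (X ^ q ^ n - X : F[X]) ∣ P * Q := by
    refine X_pow_card_pow_sub_X_dvd hn (mul_ne_zero hP.ne_zero hQ0) fun p hpm hp hpn => ?_
    by_cases hpeq : p.natDegree = n
    · exact (Finset.dvd_prod_of_mem _ ((hmem p).2 ⟨hpm, hp, hpeq⟩)).mul_right _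
    · refine Dvd.dvd.mul_left ?_ _
      have hmem' : p.natDegree ∈ Finset.Icc 1 (n / 2) := by
        obtain ⟨k, hk⟩ := hpn
        have hpos := hp.natDegree_pos
        have hk2 : 2 ≤ k := by
          rcases k with _ | _ | k
          · simp at hk; lia
          · simp at hk; lia
          · lia
        rw [Finset.mem_Icc, Nat.le_div_iff_mul_le two_pos]
        exact ⟨hpos, hk ▸ Nat.mul_le_mul_left _ hk2⟩
      refine Dvd.dvd.trans ?_ (Finset.dvd_prod_of_mem _ hmem')
      have := hp.natDegree_dvd_iff_dvd_X_pow_card_pow_sub_X.1 (dvd_refl p.natDegree)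
      rwa [Nat.card_eq_fintype_card] at this
  have := natDegree_le_of_dvd hdvd (mul_ne_zero hP.ne_zero hQ0)
  rw [FiniteField.X_pow_card_pow_sub_X_natDegree_eq F hn hq, natDegree_mul hP.ne_zero hQ0,
    hPd] at this
  lia

lemma tendsto_numIrred_atTop : Filter.Tendsto (numIrred F) Filter.atTop Filter.atTop := by
  rw [Filter.tendsto_atTop]
  intro K
  have hq : 1 < Fintype.card F := Fintype.one_lt_card
  have hlim := tendsto_pow_const_div_const_pow_of_one_lt 1
    (show (1 : ℝ) < (Fintype.card F : ℝ) by exact_mod_cast hq)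
  have hev := hlim.eventually (gt_mem_nhds (show (0 : ℝ) < 1 / (2 * (K + 1)) by positivity))
  obtain ⟨N, hN⟩ := Filter.eventually_atTop.1 hev
  filter_upwards [Filter.eventually_ge_atTop (2 * N + 1)] with n hn
  by_contra! hlt
  have h1 := card_pow_le_numIrred (F := F) (n := n) (by lia)
  set q := Fintype.card F
  have h2 := hN (n - n / 2) (by lia)
  set h := n - n / 2 with hh
  have hqpos : 0 < q ^ (n / 2) := by positivity
  have h3 : q ^ h ≤ n * (K + 1) := by
    refine Nat.le_of_mul_le_mul_right (c := q ^ (n / 2)) ?_ hqpos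
    rw [← pow_add, show h + n / 2 = n by lia, mul_assoc]
    refine h1.trans (Nat.mul_le_mul_left _ ?_)
    nlinarith
  have h4 : q ^ h ≤ 2 * h * (K + 1) := h3.trans (Nat.mul_le_mul_right _ (by lia))
  rw [pow_one, div_lt_div_iff₀ (by positivity) (by positivity)] at h2
  have h5 : (q : ℝ) ^ h ≤ 2 * h * (K + 1) := by exact_mod_cast h4
  linarith

lemma lt_numIrred_of_deltaQ_le {m d : ℕ} (hd : deltaQ F m ≤ d) :
    ⌊Real.logb (Fintype.card F) m⌋₊ + 1 < numIrred F d := by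
  have hne : {δ : ℕ | 0 < δ ∧ ∀ d : ℕ, δ ≤ d →
      ⌊Real.logb (Fintype.card F) m⌋₊ + 1 < numIrred F d}.Nonempty := by
    obtain ⟨N, hN⟩ := Filter.eventually_atTop.1
      ((tendsto_numIrred_atTop (F := F)).eventually_gt_atTop (⌊Real.logb (Fintype.card F) m⌋₊ + 1))
    exact ⟨N + 1, N.succ_pos, fun d hd => hN d (by lia)⟩
  exact (Nat.sInf_mem hne).2 d hd

lemma exists_finset_irreducible_card_eq {n d : ℕ} (h : n ≤ numIrred F d) :
    ∃ A : Finset F[X], A.card = n ∧ ∀ p ∈ A, p.Monic ∧ Irreducible p ∧ p.natDegree = d := by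
  rw [numIrred, Set.ncard_eq_toFinset_card _ (finite_setOf_monic_irreducible F d)] at h
  obtain ⟨A, hA, hcard⟩ := Finset.exists_subset_card_eq h
  exact ⟨A, hcard, fun p hp => by simpa using hA hp⟩

variable {m : ℕ} {s : F[X]}

lemma IsMaximal.dt_le_floor_logb (hm : 0 < m) (hs : IsMaximal m s) :
    dt s ≤ ⌊Real.logb (Fintype.card F) m⌋₊ + 1 := by
  have hq : 1 < Fintype.card F := Fintype.one_lt_card
  have hlt : m < Fintype.card F ^ (⌊Real.logb (Fintype.card F) m⌋₊ + 1) := by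
    have h := Nat.lt_floor_add_one (Real.logb (Fintype.card F) m)
    rw [Real.logb_lt_iff_lt_rpow (by exact_mod_cast hq) (by exact_mod_cast hm)] at h
    exact_mod_cast h
  obtain ⟨p, hpm, hp, hpn, hps⟩ := exists_irreducible_not_dvd (Nat.succ_ne_zero _) hs.1.ne_zero
    (hs.2.1.trans_lt hlt)
  exact (hs.dt_le_natDegree hpm hp hps).trans hpn

/-- If all irreducibles of degree `d ≥ δ_q(m)` have multiplicity at least `c` in a maximal
polynomial, trading `d_t(s) + 1` of them for `d` new ones of degree `d_t(s) + 1` bounds `d`. -/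
lemma IsMaximal.natCast_le_logb_mul (hm : 0 < m) (hs : IsMaximal m s) {c d : ℕ} (hc : 0 < c)
    (hd : deltaQ F m ≤ d) (hdt : d ≤ dt s)
    (hmult : ∀ p : F[X], p.Monic → Irreducible p → p.natDegree = d → c ≤ multiplicity p s) :
    (d : ℝ) ≤ Real.logb 2 (((c : ℝ) + 1) / c) * ((dt s : ℝ) + 1) := by
  have hD := hs.dt_le_floor_logb hm
  obtain ⟨A, hAc, hA⟩ := exists_finset_irreducible_card_eq (F := F) (n := dt s + 1) (d := d) (by
    have := lt_numIrred_of_deltaQ_le hd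
    lia)
  obtain ⟨B, hBc, hB⟩ := exists_finset_irreducible_card_eq (F := F) (n := d) (d := dt s + 1) (by
    have := lt_numIrred_of_deltaQ_le (F := F) (m := m) (d := dt s + 1) (by lia)
    lia)
  have key := hs.two_pow_mul_le (A := A) (B := B) (d := d) (e := dt s + 1) hc
    (fun p hp => ⟨(hA p hp).1, (hA p hp).2.1, (hA p hp).2.2,
      hmult p (hA p hp).1 (hA p hp).2.1 (hA p hp).2.2⟩)
    (fun p hp => ⟨(hB p hp).1, (hB p hp).2.1, (hB p hp).2.2, fun h => by
      have h1 := natDegree_le_dt hs.1.ne_zero (hB p hp).1 (hB p hp).2.1 h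
      have h2 := (hB p hp).2.2
      lia⟩)
    (by rw [hAc, hBc, mul_comm])
  rw [hAc, hBc] at key
  have hc' : (0 : ℝ) < c := by exact_mod_cast hc
  have key' : (2 : ℝ) ^ d ≤ (((c : ℝ) + 1) / c) ^ (dt s + 1) := by
    rw [div_pow, le_div_iff₀ (by positivity)]
    exact_mod_cast key
  have h := Real.logb_le_logb_of_le one_lt_two (by positivity) key'
  rw [Real.logb_pow, Real.logb_pow, Real.logb_self_eq_one one_lt_two, mul_one] at h
  push_cast at h
  linarith

end Counting

/-- Lemma: let `s ∈ M_m` be maximal and `p` a monic irreducible factor of `s` of degree `d`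
with `r = mult_p(s)`. (a) If `d ≥ δ_q(m)` and `r > 1` then
`d ≤ log₂(r/(r−1))·(d_t(s)+1)`. (b) If `d ≥ δ_q(m)+1` then
`d ≤ log₂((r+1)/r)·(d_t(s)+1) + 1`. -/
theorem maximal_degree_upper_bounds {F : Type} [Field F] [Fintype F]
    (m : ℕ) (hm : 0 < m) (s : F[X]) (hs : IsMaximal m s)
    (p : F[X]) (hp : p.Monic) (hpirr : Irreducible p) (hps : p ∣ s) :
    (deltaQ F m ≤ p.natDegree → 1 < multiplicity p s →
      (p.natDegree : ℝ) ≤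
        Real.logb 2 ((multiplicity p s : ℝ) / ((multiplicity p s : ℝ) - 1)) *
          ((dt s : ℝ) + 1)) ∧
    (deltaQ F m + 1 ≤ p.natDegree →
      (p.natDegree : ℝ) ≤
        Real.logb 2 (((multiplicity p s : ℝ) + 1) / (multiplicity p s : ℝ)) *
          ((dt s : ℝ) + 1) + 1) := by
  have hdt := natDegree_le_dt hs.1.ne_zero hp hpirr hps
  have hr := multiplicity_pos_of_dvd hps
  constructor
  · intro hd hr1
    have h := hs.natCast_le_logb_mul hm (c := multiplicity p s - 1) (by lia) hd hdt
      fun f hfm hf hfd => by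
        have := (hs.multiplicity_le_of_natDegree_le hp hpirr hfm hf hfd.le).1
        lia
    rw [Nat.cast_sub hr1.le, Nat.cast_one, sub_add_cancel] at h
    exact h
  · intro hd
    have h := hs.natCast_le_logb_mul hm (c := multiplicity p s) (d := p.natDegree - 1) hr
      (by lia) (by lia) fun f hfm hf hfd => by
        have hpos := hpirr.natDegree_pos
        exact (hs.multiplicity_le_of_natDegree_le hp hpirr hfm hf (by lia)).2 (by lia)
    rw [Nat.cast_sub (by lia), Nat.cast_one] at h
    linarith
end

section
/- Let n be a positive integer and let s ∈ P_{2n} be n-maximal, and set r_0 = 2n − deg s. Then: (i) for any two monic irreducible polynomials p and p' in F[x] with deg p > deg p', one has mult_p(s) ≤ mult_{p'}(s); and (ii) for every monic irreducible polynomial p in F[x] with deg p > 1, one has mult_p(s) ≤ r_0. -/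
open Polynomial

/-- `Φ_n(s)`: the number of ordered pairs `(u,v)` of monic polynomials of degree at most `n`
with `s = u·v`. -/
noncomputable def PhiN {F : Type} [Field F] (n : ℕ) (s : F[X]) : ℕ :=
  Set.ncard {uv : F[X] × F[X] | uv.1.Monic ∧ uv.1.natDegree ≤ n ∧
    uv.2.Monic ∧ uv.2.natDegree ≤ n ∧ s = uv.1 * uv.2}

/-- `s` is `n`-maximal: `s` is monic of degree at most `2n` and `Φ_n(s) = Υ_{n,n}`. -/
def IsNMaximal {F : Type} [Field F] (n : ℕ) (s : F[X]) : Prop :=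
  s.Monic ∧ s.natDegree ≤ 2 * n ∧
    ∀ t : F[X], t.Monic → t.natDegree ≤ 2 * n → PhiN n t ≤ PhiN n s

/-- If every value in a multiset is at most one more than the sum of the strictly smaller values,
then every number up to the total is the sum of a sub-multiset. -/
theorem exists_le_sum_map_eq {α : Type*} (f : α → ℕ) (S : Multiset α)
    (hS : ∀ x ∈ S, f x ≤ 1 + ((S.filter (fun y => f y < f x)).map f).sum)
    (m : ℕ) (hm : m ≤ (S.map f).sum) : ∃ R ≤ S, (R.map f).sum = m := by
  classical
  induction hc : S.card generalizing S m with
  | zero =>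
    obtain rfl := Multiset.card_eq_zero.mp hc
    exact ⟨0, le_rfl, by simpa [eq_comm] using hm⟩
  | succ c ih =>
    have hne : S ≠ 0 := by rintro rfl; simp at hc
    obtain ⟨x, hx, hmax⟩ := Multiset.exists_max_image f hne
    obtain ⟨S₀, rfl⟩ := Multiset.exists_cons_of_mem hx
    have hfilter : ∀ y ∈ x ::ₘ S₀, (x ::ₘ S₀).filter (fun z => f z < f y) =
        S₀.filter (fun z => f z < f y) := fun y hy =>
      Multiset.filter_cons_of_neg _ (hmax y hy).not_gt
    have hS₀ : ∀ y ∈ S₀, f y ≤ 1 + ((S₀.filter (fun z => f z < f y)).map f).sum := fun y hy => by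
      have hy' : y ∈ x ::ₘ S₀ := Multiset.mem_cons_of_mem hy
      simpa only [hfilter y hy'] using hS y hy'
    have hcard : S₀.card = c := by simpa using hc
    by_cases hm₀ : m ≤ (S₀.map f).sum
    · obtain ⟨R, hR, hsum⟩ := ih S₀ hS₀ m hm₀ hcard
      exact ⟨R, hR.trans (Multiset.le_cons_self _ _), hsum⟩
    · have hle : f x ≤ 1 + (S₀.map f).sum := by
        have h := hS x hx
        rw [hfilter x hx] at h
        have h' := congrArg Multiset.sum (congrArg (Multiset.map f)
          (Multiset.filter_add_not (fun z => f z < f x) S₀))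
        rw [Multiset.map_add, Multiset.sum_add] at h'
        omega
      rw [Multiset.map_cons, Multiset.sum_cons] at hm
      obtain ⟨R, hR, hsum⟩ := ih S₀ hS₀ (m - f x) (by omega) hcard
      refine ⟨x ::ₘ R, Multiset.cons_le_cons x hR, ?_⟩
      rw [Multiset.map_cons, Multiset.sum_cons]
      omega

section Factorization

open UniqueFactorizationMonoid

variable {F : Type} [Field F]

theorem natDegree_eq_sum_normalizedFactors [DecidableEq F] {f : F[X]} (hf : f ≠ 0) :
    ((normalizedFactors f).map natDegree).sum = f.natDegree := by
  have h0 : (0 : F[X]) ∉ normalizedFactors f := zero_notMem_normalizedFactors f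
  rw [← natDegree_multiset_prod _ h0]
  exact natDegree_eq_of_degree_eq
    (degree_eq_degree_of_associated (prod_normalizedFactors hf))

theorem squarefree_X_pow_card_pow_sub_X [Fintype F] {k : ℕ} (hk : k ≠ 0) :
    Squarefree (X ^ Nat.card F ^ k - X : F[X]) := by
  obtain ⟨c, hc⟩ := CharP.exists F
  have hdvd : c ∣ Nat.card F := by
    rw [← CharP.cast_eq_zero_iff F, Nat.card_eq_fintype_card]
    exact Nat.cast_card_eq_zero F
  exact (galois_poly_separable c _ (hdvd.trans (dvd_pow_self _ hk))).squarefree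

/-- The irreducibles of degree less than `k`, with one of them excluded, have total degree at
least `k - 1`. -/
theorem exists_finset_monic_irreducible [Fintype F] (p : F[X]) (k : ℕ) :
    ∃ A : Finset F[X], (∀ Q ∈ A, Q.Monic ∧ Irreducible Q ∧ Q.natDegree < k ∧ Q ≠ p) ∧
      k ≤ 1 + ∑ Q ∈ A, Q.natDegree := by
  classical
  obtain hk | ⟨l, hl, rfl⟩ : k ≤ 1 ∨ ∃ l, l ≠ 0 ∧ k = l + 1 := by
    rcases k with _ | _ | l
    · simp
    · simp
    · exact Or.inr ⟨l + 1, by simp, rfl⟩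
  · exact ⟨∅, by simp, by simpa using hk⟩
  have hq : 1 < Nat.card F := Finite.one_lt_card
  set G : F[X] := X ^ Nat.card F ^ l - X with hG
  have hG0 : G ≠ 0 := FiniteField.X_pow_card_pow_sub_X_ne_zero F hl hq
  have hdeg : ∀ Q, Irreducible Q → Q ∣ G → Q.natDegree ≤ l := fun Q hQ hQG =>
    Nat.le_of_dvd (Nat.pos_of_ne_zero hl) (hQ.natDegree_dvd_of_dvd_X_pow_card_pow_sub_X hQG)
  have hmem : ∀ Q ∈ (normalizedFactors G).toFinset, Q.Monic ∧ Irreducible Q ∧ Q.natDegree ≤ l := by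
    intro Q hQ
    rw [Multiset.mem_toFinset, Polynomial.mem_normalizedFactors_iff hG0] at hQ
    exact ⟨hQ.2.1, hQ.1, hdeg Q hQ.1 hQ.2.2⟩
  have hsum : ∑ Q ∈ (normalizedFactors G).toFinset, Q.natDegree = Nat.card F ^ l := by
    have hnd := (squarefree_iff_nodup_normalizedFactors hG0).mp
      (squarefree_X_pow_card_pow_sub_X hl)
    rw [Finset.sum, Multiset.toFinset_val, hnd.dedup, natDegree_eq_sum_normalizedFactors hG0,
      hG, FiniteField.X_pow_card_pow_sub_X_natDegree_eq F hl hq]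
  have hpow : 2 * l ≤ Nat.card F ^ l :=
    calc 2 * l ≤ 2 ^ l := by
          obtain ⟨r, rfl⟩ := Nat.exists_eq_succ_of_ne_zero hl
          have := r.lt_two_pow_self
          rw [Nat.succ_eq_add_one, pow_succ]
          omega
      _ ≤ _ := Nat.pow_le_pow_left hq l
  refine ⟨(normalizedFactors G).toFinset.erase p, fun Q hQ => ?_, ?_⟩
  · rw [Finset.mem_erase] at hQ
    obtain ⟨h1, h2, h3⟩ := hmem Q hQ.2
    exact ⟨h1, h2, by omega, hQ.1⟩
  · by_cases hp : p ∈ (normalizedFactors G).toFinset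
    · have := Finset.add_sum_erase _ natDegree hp
      have := (hmem p hp).2.2
      omega
    · rw [Finset.erase_eq_of_notMem hp]
      omega

/-- If every irreducible factor of `T` forces all monic irreducibles of smaller degree, except
possibly `p`, to divide `T`, then `T` has monic divisors of every degree up to its own. -/
theorem exists_monic_mul_eq_of_natDegree_le [Fintype F] {T p : F[X]} (hT : T.Monic)
    (h : ∀ P Q : F[X], P.Monic → Irreducible P → Q.Monic → Irreducible Q →
      Q.natDegree < P.natDegree → Q ≠ p → P ∣ T → Q ∣ T)
    {m : ℕ} (hm : m ≤ T.natDegree) :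
    ∃ u v : F[X], u.Monic ∧ v.Monic ∧ T = u * v ∧ u.natDegree = m := by
  classical
  have hT0 := hT.ne_zero
  obtain ⟨R, hR, hsum⟩ := exists_le_sum_map_eq natDegree (normalizedFactors T) (fun P hP => by
    rw [Polynomial.mem_normalizedFactors_iff hT0] at hP
    obtain ⟨A, hA, hAsum⟩ := exists_finset_monic_irreducible p P.natDegree
    have hle : A.val ≤ (normalizedFactors T).filter (fun Q => Q.natDegree < P.natDegree) := by
      rw [Multiset.le_iff_subset A.nodup]
      intro Q hQ
      obtain ⟨h1, h2, h3, h4⟩ := hA Q hQ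
      rw [Multiset.mem_filter, Polynomial.mem_normalizedFactors_iff hT0]
      exact ⟨⟨h2, h1, h P Q hP.2.1 hP.1 h1 h2 h3 h4 hP.2.2⟩, h3⟩
    obtain ⟨B, hB⟩ := Multiset.le_iff_exists_add.mp hle
    rw [hB, Multiset.map_add, Multiset.sum_add]
    exact hAsum.trans (Nat.add_le_add_left (Nat.le_add_right _ _) 1)) m
    (by rwa [natDegree_eq_sum_normalizedFactors hT0])
  have hmonic : ∀ Q ∈ R, Q.Monic := fun Q hQ =>
    ((Polynomial.mem_normalizedFactors_iff hT0).mp (Multiset.mem_of_le hR hQ)).2.1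
  have hu : R.prod.Monic := by
    have := monic_multiset_prod_of_monic R id (by simpa using hmonic)
    simpa using this
  obtain ⟨v, hv⟩ : R.prod ∣ T :=
    (Multiset.prod_dvd_prod_of_le hR).trans (prod_normalizedFactors hT0).dvd
  refine ⟨R.prod, v, hu, hu.of_mul_monic_left (hv ▸ hT), hv, ?_⟩
  rw [natDegree_multiset_prod_of_monic R hmonic, hsum]

end Factorization

section FactorPairs

variable {F : Type} [Field F]

/-- The set counted by `PhiN n s`. -/
def factorPairs (n : ℕ) (s : F[X]) : Set (F[X] × F[X]) :=
  {uv | uv.1.Monic ∧ uv.1.natDegree ≤ n ∧ uv.2.Monic ∧ uv.2.natDegree ≤ n ∧ s = uv.1 * uv.2}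

theorem phiN_eq_ncard_factorPairs (n : ℕ) (s : F[X]) : PhiN n s = (factorPairs n s).ncard := rfl

theorem finite_natDegree_le [Finite F] (n : ℕ) : {f : F[X] | f.natDegree ≤ n}.Finite := by
  refine Set.Finite.of_injOn (f := fun (f : F[X]) (i : Fin (n + 1)) => f.coeff i)
    (t := Set.univ) (fun _ _ => Set.mem_univ _) (fun f hf g hg hfg => ?_) Set.finite_univ
  ext i
  by_cases hi : i ≤ n
  · exact congrFun hfg ⟨i, by omega⟩
  · rw [coeff_eq_zero_of_natDegree_lt (lt_of_le_of_lt hf (not_le.mp hi)),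
      coeff_eq_zero_of_natDegree_lt (lt_of_le_of_lt hg (not_le.mp hi))]

theorem finite_factorPairs [Finite F] (n : ℕ) (s : F[X]) : (factorPairs n s).Finite :=
  ((finite_natDegree_le n).prod (finite_natDegree_le n)).subset fun _ h => ⟨h.2.1, h.2.2.2.1⟩

theorem ncard_lt_ncard_of_injOn {α β : Type*} {A : Set α} {B : Set β} (hB : B.Finite)
    (f : α → β) (hf : Set.MapsTo f A B) (hinj : A.InjOn f) {y : β} (hy : y ∈ B)
    (hyA : ∀ x ∈ A, f x ≠ y) : A.ncard < B.ncard := by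
  rw [← hinj.ncard_image]
  refine Set.ncard_lt_ncard ⟨hf.image_subset, fun h => ?_⟩ hB
  obtain ⟨x, hx, hxy⟩ := h hy
  exact hyA x hx hxy

theorem phiN_lt_phiN_mul_X [Finite F] {n : ℕ} {s : F[X]} (hs : s.Monic) (hdeg : s.natDegree < n) :
    PhiN n s < PhiN n (s * X) := by
  refine ncard_lt_ncard_of_injOn (finite_factorPairs n _) (fun x => (x.1 * X, x.2))
    ?_ ?_ (y := (1, s * X)) ?_ ?_
  · rintro ⟨u, v⟩ ⟨hu, -, hv, hvn, rfl⟩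
    dsimp only at hu hv hvn hdeg
    rw [hu.natDegree_mul hv] at hdeg
    refine ⟨hu.mul monic_X, ?_, hv, hvn, by ring⟩
    dsimp only
    rw [natDegree_mul_X hu.ne_zero]
    omega
  · rintro ⟨u, v⟩ - ⟨u', v'⟩ - h
    simp only [Prod.mk.injEq] at h ⊢
    exact ⟨mul_right_cancel₀ X_ne_zero h.1, h.2⟩
  · refine ⟨monic_one, by simp, hs.mul monic_X, ?_, (one_mul _).symm⟩
    dsimp only
    rw [natDegree_mul_X hs.ne_zero]
    omega
  · rintro ⟨u, v⟩ - h
    simp only [Prod.mk.injEq] at h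
    have : IsUnit (X : F[X]) := IsUnit.of_mul_eq_one_right u h.1
    exact not_isUnit_X this

theorem IsNMaximal.le_natDegree [Finite F] {n : ℕ} {s : F[X]} (hs : IsNMaximal n s) :
    n ≤ s.natDegree := by
  by_contra! h
  refine (phiN_lt_phiN_mul_X hs.1 h).not_ge (hs.2.2 _ (hs.1.mul monic_X) ?_)
  rw [natDegree_mul_X hs.1.ne_zero]
  omega

theorem IsNMaximal.factorPairs_nonempty [Finite F] {n : ℕ} {s : F[X]} (hs : IsNMaximal n s) :
    (factorPairs n s).Nonempty := by
  have h1 : (factorPairs n (1 : F[X])).Nonempty :=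
    ⟨(1, 1), monic_one, by simp, monic_one, by simp, by simp⟩
  have h2 := hs.2.2 1 monic_one (by simp)
  rw [phiN_eq_ncard_factorPairs, phiN_eq_ncard_factorPairs] at h2
  exact Set.nonempty_of_ncard_ne_zero
    (((Set.ncard_pos (finite_factorPairs n _)).mpr h1).trans_le h2).ne'

theorem eq_and_eq_of_mul_pow_eq {p a b : F[X]} (hp : Prime p) (ha : ¬ p ∣ a) (hb : ¬ p ∣ b)
    {i j : ℕ} (h : a * p ^ i = b * p ^ j) : i = j ∧ a = b := by
  have key : ∀ {a b : F[X]} {i j : ℕ}, ¬ p ∣ a → a * p ^ i = b * p ^ j → j ≤ i := by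
    intro a b i j ha h
    by_contra! hij
    obtain ⟨c, rfl⟩ := Nat.exists_eq_add_of_lt hij
    refine ha ⟨b * p ^ c, mul_right_cancel₀ (pow_ne_zero i hp.ne_zero) ?_⟩
    rw [h]
    ring
  obtain rfl := le_antisymm (key hb h.symm) (key ha h)
  exact ⟨rfl, mul_right_cancel₀ (pow_ne_zero i hp.ne_zero) h⟩

theorem exists_monic_of_mul_eq_mul_pow {p u v w : F[X]} (hp : Prime p) (hpm : p.Monic)
    (hu : u.Monic) (hv : v.Monic) {e : ℕ} (h : u * v = w * p ^ e) :
    ∃ (i k : ℕ) (u₀ v₀ : F[X]), i + k = e ∧ u₀.Monic ∧ v₀.Monic ∧ w = u₀ * v₀ ∧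
      u = u₀ * p ^ i ∧ v = v₀ * p ^ k := by
  obtain ⟨i, k, u₀, v₀, hik, hw, rfl, rfl⟩ := mul_eq_mul_prime_pow hp h
  exact ⟨i, k, u₀, v₀, hik, (hpm.pow i).of_mul_monic_right hu, (hpm.pow k).of_mul_monic_right hv,
    hw, rfl, rfl⟩

/-- The tuples `(u, v, i, k)` describing the pairs `(u * p ^ i, v * p ^ k)` counted by
`PhiN n (w * p ^ e)`. -/
def primeSplittings (n : ℕ) (w p : F[X]) (e : ℕ) : Set (F[X] × F[X] × ℕ × ℕ) :=
  {x | x.1.Monic ∧ x.2.1.Monic ∧ w = x.1 * x.2.1 ∧ x.2.2.1 + x.2.2.2 = e ∧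
    x.1.natDegree + x.2.2.1 * p.natDegree ≤ n ∧ x.2.1.natDegree + x.2.2.2 * p.natDegree ≤ n}

theorem bijOn_primeSplittings {n : ℕ} {w p : F[X]} (hpm : p.Monic) (hp : Prime p)
    (hpw : ¬ p ∣ w) (e : ℕ) :
    Set.BijOn (fun x : F[X] × F[X] × ℕ × ℕ => (x.1 * p ^ x.2.2.1, x.2.1 * p ^ x.2.2.2))
      (primeSplittings n w p e) (factorPairs n (w * p ^ e)) := by
  refine ⟨?_, ?_, ?_⟩
  · rintro ⟨u, v, i, k⟩ ⟨hu, hv, rfl, rfl, hun, hvn⟩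
    refine ⟨hu.mul (hpm.pow i), ?_, hv.mul (hpm.pow k), ?_, by ring⟩
    · simpa [hu.natDegree_mul (hpm.pow i), hpm.natDegree_pow] using hun
    · simpa [hv.natDegree_mul (hpm.pow k), hpm.natDegree_pow] using hvn
  · rintro ⟨u, v, i, k⟩ ⟨-, -, hw, hik, -, -⟩ ⟨u', v', i', k'⟩ ⟨-, -, hw', hik', -, -⟩ h
    simp only [Prod.mk.injEq] at h hw hw' hik hik' ⊢
    have hu : ¬ p ∣ u := fun hd => hpw (hw ▸ hd.mul_right v)
    have hu' : ¬ p ∣ u' := fun hd => hpw (hw' ▸ hd.mul_right v')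
    have hv : ¬ p ∣ v := fun hd => hpw (hw ▸ hd.mul_left u)
    have hv' : ¬ p ∣ v' := fun hd => hpw (hw' ▸ hd.mul_left u')
    obtain ⟨h1, h2⟩ := eq_and_eq_of_mul_pow_eq hp hu hu' h.1
    obtain ⟨h3, h4⟩ := eq_and_eq_of_mul_pow_eq hp hv hv' h.2
    exact ⟨h2, h4, h1, h3⟩
  · rintro ⟨u, v⟩ ⟨hu, hun, hv, hvn, h⟩
    obtain ⟨i, k, u₀, v₀, hik, hu₀, hv₀, hw, rfl, rfl⟩ :=
      exists_monic_of_mul_eq_mul_pow hp hpm hu hv h.symm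
    rw [hu₀.natDegree_mul (hpm.pow i), hpm.natDegree_pow] at hun
    rw [hv₀.natDegree_mul (hpm.pow k), hpm.natDegree_pow] at hvn
    exact ⟨(u₀, v₀, i, k), ⟨hu₀, hv₀, hw, hik, hun, hvn⟩, rfl⟩

/-- The tuples `(u, v, i, k, j, l)` describing the pairs `(u * p ^ i * p' ^ j, v * p ^ k * p' ^ l)`
counted by `PhiN n (w * p ^ a * p' ^ b)`. -/
def primePairSplittings (n : ℕ) (w p p' : F[X]) (a b : ℕ) :
    Set (F[X] × F[X] × ℕ × ℕ × ℕ × ℕ) :=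
  {x | x.1.Monic ∧ x.2.1.Monic ∧ w = x.1 * x.2.1 ∧
    x.2.2.1 + x.2.2.2.1 = a ∧ x.2.2.2.2.1 + x.2.2.2.2.2 = b ∧
    x.1.natDegree + x.2.2.1 * p.natDegree + x.2.2.2.2.1 * p'.natDegree ≤ n ∧
    x.2.1.natDegree + x.2.2.2.1 * p.natDegree + x.2.2.2.2.2 * p'.natDegree ≤ n}

theorem bijOn_primePairSplittings {n : ℕ} {w p p' : F[X]} (hpm : p.Monic) (hp : Prime p)
    (hpm' : p'.Monic) (hp' : Prime p') (hpp' : ¬ p' ∣ p) (hpw : ¬ p ∣ w) (hpw' : ¬ p' ∣ w)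
    (a b : ℕ) :
    Set.BijOn (fun x : F[X] × F[X] × ℕ × ℕ × ℕ × ℕ =>
        (x.1 * p ^ x.2.2.1 * p' ^ x.2.2.2.2.1, x.2.1 * p ^ x.2.2.2.1 * p' ^ x.2.2.2.2.2))
      (primePairSplittings n w p p' a b) (factorPairs n (w * p ^ a * p' ^ b)) := by
  refine ⟨?_, ?_, ?_⟩
  · rintro ⟨u, v, i, k, j, l⟩ ⟨hu, hv, rfl, rfl, rfl, hun, hvn⟩
    refine ⟨(hu.mul (hpm.pow i)).mul (hpm'.pow j), ?_, (hv.mul (hpm.pow k)).mul (hpm'.pow l), ?_,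
      by ring⟩
    · simpa [(hu.mul (hpm.pow i)).natDegree_mul (hpm'.pow j), hu.natDegree_mul (hpm.pow i),
        hpm.natDegree_pow, hpm'.natDegree_pow] using hun
    · simpa [(hv.mul (hpm.pow k)).natDegree_mul (hpm'.pow l), hv.natDegree_mul (hpm.pow k),
        hpm.natDegree_pow, hpm'.natDegree_pow] using hvn
  · rintro ⟨u, v, i, k, j, l⟩ ⟨-, -, hw, -⟩ ⟨u', v', i', k', j', l'⟩ ⟨-, -, hw', -⟩ h
    simp only [Prod.mk.injEq] at h hw hw' ⊢
    have key : ∀ {x : F[X]} (i : ℕ), x ∣ w → ¬ p' ∣ x * p ^ i := fun i hx hd =>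
      (hp'.dvd_or_dvd hd).elim (fun h => hpw' (h.trans hx)) fun h => hpp' (hp'.dvd_of_dvd_pow h)
    have hu : u ∣ w := ⟨v, hw⟩
    have hu' : u' ∣ w := ⟨v', hw'⟩
    have hv : v ∣ w := ⟨u, by rw [hw, mul_comm]⟩
    have hv' : v' ∣ w := ⟨u', by rw [hw', mul_comm]⟩
    obtain ⟨h1, h2⟩ := eq_and_eq_of_mul_pow_eq hp' (key i hu) (key i' hu') h.1
    obtain ⟨h3, h4⟩ := eq_and_eq_of_mul_pow_eq hp' (key k hv) (key k' hv') h.2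
    obtain ⟨h5, h6⟩ := eq_and_eq_of_mul_pow_eq hp (fun h => hpw (h.trans hu))
      (fun h => hpw (h.trans hu')) h2
    obtain ⟨h7, h8⟩ := eq_and_eq_of_mul_pow_eq hp (fun h => hpw (h.trans hv))
      (fun h => hpw (h.trans hv')) h4
    exact ⟨h6, h8, h5, h7, h1, h3⟩
  · rintro ⟨u, v⟩ ⟨hu, hun, hv, hvn, h⟩
    obtain ⟨j, l, u₁, v₁, hjl, hu₁, hv₁, hw₁, rfl, rfl⟩ :=
      exists_monic_of_mul_eq_mul_pow hp' hpm' hu hv h.symm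
    obtain ⟨i, k, u₀, v₀, hik, hu₀, hv₀, hw, rfl, rfl⟩ :=
      exists_monic_of_mul_eq_mul_pow hp hpm hu₁ hv₁ hw₁.symm
    rw [hu₁.natDegree_mul (hpm'.pow j), hu₀.natDegree_mul (hpm.pow i), hpm.natDegree_pow,
      hpm'.natDegree_pow] at hun
    rw [hv₁.natDegree_mul (hpm'.pow l), hv₀.natDegree_mul (hpm.pow k), hpm.natDegree_pow,
      hpm'.natDegree_pow] at hvn
    exact ⟨(u₀, v₀, i, k, j, l), ⟨hu₀, hv₀, hw, hik, hjl, hun, hvn⟩, rfl⟩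

theorem phiN_eq_ncard_primeSplittings {n : ℕ} {w p : F[X]} (hpm : p.Monic) (hp : Prime p)
    (hpw : ¬ p ∣ w) (e : ℕ) : PhiN n (w * p ^ e) = (primeSplittings n w p e).ncard := by
  have h := bijOn_primeSplittings (n := n) hpm hp hpw e
  rw [phiN_eq_ncard_factorPairs, ← h.image_eq, h.injOn.ncard_image]

theorem phiN_eq_ncard_primePairSplittings {n : ℕ} {w p p' : F[X]} (hpm : p.Monic) (hp : Prime p)
    (hpm' : p'.Monic) (hp' : Prime p') (hpp' : ¬ p' ∣ p) (hpw : ¬ p ∣ w) (hpw' : ¬ p' ∣ w)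
    (a b : ℕ) :
    PhiN n (w * p ^ a * p' ^ b) = (primePairSplittings n w p p' a b).ncard := by
  have h := bijOn_primePairSplittings (n := n) hpm hp hpm' hp' hpp' hpw hpw' a b
  rw [phiN_eq_ncard_factorPairs, ← h.image_eq, h.injOn.ncard_image]

/-- Trades factors `p` for factors `p'` in both halves of a splitting, keeping the number of
factors in each half. -/
def tradeFactors (a b : ℕ) (x : F[X] × F[X] × ℕ × ℕ × ℕ × ℕ) : F[X] × F[X] × ℕ × ℕ × ℕ × ℕ :=
  let c := (x.2.2.1 + x.2.2.2.2.1 - b) - (x.2.2.1 + x.2.2.2.2.1 - a)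
  (x.1, x.2.1, x.2.2.1 - c, x.2.2.2.1 - (a - b - c), x.2.2.2.2.1 + c, x.2.2.2.2.2 + (a - b - c))

theorem sub_mul_add_add_mul_le {d d' i c : ℕ} (hd : d' ≤ d) (hc : c ≤ i) (j : ℕ) :
    (i - c) * d + (j + c) * d' ≤ i * d + j * d' := by
  obtain ⟨r, rfl⟩ := Nat.exists_eq_add_of_le' hc
  rw [Nat.add_sub_cancel]
  nlinarith [Nat.mul_le_mul_left c hd]

theorem mapsTo_tradeFactors {n a b : ℕ} {w p p' : F[X]} (hab : b ≤ a)
    (hdeg : p'.natDegree ≤ p.natDegree) :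
    Set.MapsTo (tradeFactors a b) (primePairSplittings n w p p' a b)
      (primePairSplittings n w p p' b a) := by
  rintro ⟨u, v, i, k, j, l⟩ ⟨hu, hv, hw, hik, hjl, hun, hvn⟩
  dsimp only at hu hv hw hik hjl hun hvn
  refine ⟨hu, hv, hw, ?_, ?_, ?_, ?_⟩ <;> dsimp only [tradeFactors]
  · omega
  · omega
  · have := sub_mul_add_add_mul_le hdeg (i := i) (c := (i + j - b) - (i + j - a)) (by omega) j
    omega
  · have := sub_mul_add_add_mul_le hdeg (i := k) (c := a - b - ((i + j - b) - (i + j - a)))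
      (by omega) l
    omega

theorem injOn_tradeFactors {n a b : ℕ} {w p p' : F[X]} (hab : b ≤ a) :
    (primePairSplittings n w p p' a b).InjOn (tradeFactors a b) := by
  rintro ⟨u, v, i, k, j, l⟩ ⟨-, -, -, hik, hjl, -⟩
    ⟨u', v', i', k', j', l'⟩ ⟨-, -, -, hik', hjl', -⟩ h
  simp only [tradeFactors, Prod.mk.injEq] at hik hjl hik' hjl' h ⊢
  refine ⟨h.1, h.2.1, ?_⟩
  omega

theorem finite_primePairSplittings [Finite F] {n : ℕ} {w p p' : F[X]} (hpm : p.Monic)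
    (hp : Prime p) (hpm' : p'.Monic) (hp' : Prime p') (hpp' : ¬ p' ∣ p) (hpw : ¬ p ∣ w)
    (hpw' : ¬ p' ∣ w) (a b : ℕ) : (primePairSplittings n w p p' a b).Finite :=
  (bijOn_primePairSplittings hpm hp hpm' hp' hpp' hpw hpw' a b).finite_iff_finite.mpr
    (finite_factorPairs _ _)

theorem phiN_le_phiN_swap [Finite F] {n a b : ℕ} {w p p' : F[X]} (hpm : p.Monic) (hp : Prime p)
    (hpm' : p'.Monic) (hp' : Prime p') (hpp' : ¬ p' ∣ p) (hpw : ¬ p ∣ w) (hpw' : ¬ p' ∣ w)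
    (hab : b ≤ a) (hdeg : p'.natDegree ≤ p.natDegree) :
    PhiN n (w * p ^ a * p' ^ b) ≤ PhiN n (w * p ^ b * p' ^ a) := by
  rw [phiN_eq_ncard_primePairSplittings hpm hp hpm' hp' hpp' hpw hpw',
    phiN_eq_ncard_primePairSplittings hpm hp hpm' hp' hpp' hpw hpw']
  exact Set.ncard_le_ncard_of_injOn _ (mapsTo_tradeFactors hab hdeg) (injOn_tradeFactors hab)
    (finite_primePairSplittings hpm hp hpm' hp' hpp' hpw hpw' b a)

theorem phiN_lt_phiN_swap [Finite F] {n a b : ℕ} {w p p' : F[X]} (hpm : p.Monic) (hp : Prime p)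
    (hpm' : p'.Monic) (hp' : Prime p') (hpp' : ¬ p' ∣ p) (hpw : ¬ p ∣ w) (hpw' : ¬ p' ∣ w)
    (hab : b < a) (hdeg : p'.natDegree < p.natDegree) {u v : F[X]} {i k j l : ℕ}
    (hmem : (u, v, i, k, j, l) ∈ primePairSplittings n w p p' b a) (hij : b < i + j)
    (hn : n = u.natDegree + i * p.natDegree + j * p'.natDegree) :
    PhiN n (w * p ^ a * p' ^ b) < PhiN n (w * p ^ b * p' ^ a) := by
  rw [phiN_eq_ncard_primePairSplittings hpm hp hpm' hp' hpp' hpw hpw',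
    phiN_eq_ncard_primePairSplittings hpm hp hpm' hp' hpp' hpw hpw']
  refine ncard_lt_ncard_of_injOn (finite_primePairSplittings hpm hp hpm' hp' hpp' hpw hpw' b a) _
    (mapsTo_tradeFactors hab.le hdeg.le) (injOn_tradeFactors hab.le) hmem ?_
  rintro ⟨u', v', i', k', j', l'⟩ ⟨-, -, -, hik, hjl, hun, -⟩ h
  simp only [tradeFactors, Prod.mk.injEq] at hik hjl hun h
  obtain ⟨rfl, -, hi, -, hj, -⟩ := h
  set c := (i' + j' - b) - (i' + j' - a) with hc
  have hi' : i' = i + c := by omega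
  have hc0 : 0 < c := by omega
  clear_value c
  subst hi' hj
  nlinarith [Nat.mul_lt_mul_of_pos_left hdeg hc0]

theorem phiN_lt_phiN_of_lt [Finite F] {n e r : ℕ} {w p u v : F[X]} (hpm : p.Monic) (hp : Prime p)
    (hpw : ¬ p ∣ w) (hr : r + w.natDegree + (e + 1) * p.natDegree = 2 * n)
    (hu : u.Monic) (hv : v.Monic) (hw : w = u * v) (hvr : r < n - v.natDegree)
    (hvn : n - v.natDegree < (e + 1) * p.natDegree) :
    PhiN n (w * p ^ (e + 1)) < PhiN n (w * p ^ e) := by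
  rw [phiN_eq_ncard_primeSplittings hpm hp hpw, phiN_eq_ncard_primeSplittings hpm hp hpw]
  have hd0 : 0 < p.natDegree := by
    by_contra! h
    simp [Nat.le_zero.mp h] at hvn
  have hmem : ∀ {u v : F[X]}, u.Monic → v.Monic → w = u * v → v.natDegree ≤ n →
      n - v.natDegree < (e + 1) * p.natDegree →
      (u, v, e - (n - v.natDegree) / p.natDegree, (n - v.natDegree) / p.natDegree) ∈
        primeSplittings n w p e := by
    intro u v hu hv hw hvn hlt
    have hdiv := (Nat.div_lt_iff_lt_mul hd0).mpr hlt
    have hle := Nat.div_mul_le_self (n - v.natDegree) p.natDegree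
    have hlt' := Nat.lt_div_mul_add hd0 (a := n - v.natDegree)
    have hwdeg : w.natDegree = u.natDegree + v.natDegree := by rw [hw, hu.natDegree_mul hv]
    refine ⟨hu, hv, hw, by dsimp only; omega, ?_, by dsimp only; omega⟩
    dsimp only
    rw [Nat.sub_mul]
    have hmul := Nat.mul_le_mul_right p.natDegree (Nat.lt_succ_iff.mp hdiv)
    rw [Nat.add_mul] at hr
    omega
  have hlast : ∀ {u v : F[X]} {i : ℕ}, (u, v, i, 0) ∈ primeSplittings n w p (e + 1) →
      n - v.natDegree ≤ r := by
    rintro u v i ⟨hu, hv, hw, hi, hun, -⟩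
    dsimp only at hu hv hw hi hun
    obtain rfl : i = e + 1 := by omega
    have hwdeg : w.natDegree = u.natDegree + v.natDegree := by rw [hw, hu.natDegree_mul hv]
    omega
  have hlarge : ∀ {u v : F[X]} {i k : ℕ}, (u, v, i, k + 1) ∈ primeSplittings n w p (e + 1) →
      k ≠ (n - v.natDegree) / p.natDegree := by
    rintro u v i k ⟨-, -, -, -, -, hvn⟩ rfl
    dsimp only at hvn
    have := (Nat.le_div_iff_mul_le hd0).mpr (Nat.le_sub_of_add_le' hvn)
    omega
  have hfin : (primeSplittings n w p e).Finite :=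
    (bijOn_primeSplittings hpm hp hpw e).finite_iff_finite.mpr (finite_factorPairs _ _)
  refine ncard_lt_ncard_of_injOn hfin (fun x : F[X] × F[X] × ℕ × ℕ =>
      if x.2.2.2 = 0 then
        (x.1, x.2.1, e - (n - x.2.1.natDegree) / p.natDegree, (n - x.2.1.natDegree) / p.natDegree)
      else (x.1, x.2.1, x.2.2.1, x.2.2.2 - 1)) ?_ ?_
    (hmem hu hv hw (by omega) hvn) ?_
  · rintro ⟨u, v, i, _ | k⟩ h
    · have hB := hlast h
      obtain ⟨hu, hv, hw, -, -, hvn⟩ := h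
      refine hmem hu hv hw (by simpa using hvn) ?_
      dsimp only
      nlinarith
    · obtain ⟨hu, hv, hw, hik, hun, hvn⟩ := h
      dsimp only at hik hvn
      simp only [Nat.add_one_ne_zero, if_false, Nat.add_sub_cancel]
      refine ⟨hu, hv, hw, ?_, hun, ?_⟩
      · dsimp only
        omega
      · dsimp only
        nlinarith
  · rintro ⟨u, v, i, _ | k⟩ h ⟨u', v', i', _ | k'⟩ h' heq <;>
      simp only [if_true, Nat.add_sub_cancel, Nat.add_one_ne_zero, if_false, Prod.mk.injEq]
        at heq ⊢ <;> obtain ⟨rfl, rfl, h1, h2⟩ := heq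
    · have h3 := h.2.2.2.1
      have h4 := h'.2.2.2.1
      dsimp only at h3 h4
      exact ⟨rfl, rfl, by omega, trivial⟩
    · exact absurd h2.symm (hlarge h')
    · exact absurd h2 (hlarge h)
    · exact ⟨rfl, rfl, h1, by omega⟩
  · rintro ⟨u', v', i', _ | k'⟩ h heq <;>
      simp only [if_true, Nat.add_sub_cancel, Nat.add_one_ne_zero, if_false, Prod.mk.injEq]
        at heq <;> obtain ⟨rfl, rfl, h1, h2⟩ := heq
    · have := hlast h
      omega
    · exact hlarge h h2

end FactorPairs

section Maximal

variable {F : Type} [Field F]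

theorem not_dvd_of_monic_irreducible_of_ne {p p' : F[X]} (hpm : p.Monic) (hp : Irreducible p)
    (hpm' : p'.Monic) (hp' : Irreducible p') (h : p' ≠ p) : ¬ p' ∣ p := fun hd =>
  h (eq_of_monic_of_associated hpm' hpm (hp'.associated_of_dvd hp hd))

theorem finiteMultiplicity_of_irreducible {p s : F[X]} (hp : Irreducible p) (hs : s ≠ 0) :
    FiniteMultiplicity p s :=
  FiniteMultiplicity.of_not_isUnit hp.not_isUnit hs

/-- Multiplicities in `s` are non-increasing in the degree of the monic irreducible. -/
def MultAntitone (s : F[X]) : Prop :=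
  ∀ p p' : F[X], p.Monic → Irreducible p → p'.Monic → Irreducible p' →
    p'.natDegree < p.natDegree → multiplicity p s ≤ multiplicity p' s

theorem MultAntitone.exists_monic_mul_eq [Fintype F] {s T p : F[X]} (hs : MultAntitone s)
    (hpm : p.Monic) (hp : Irreducible p) (hT : T.Monic) {e : ℕ} (hsT : s = T * p ^ e) {m : ℕ}
    (hm : m ≤ T.natDegree) :
    ∃ u v : F[X], u.Monic ∧ v.Monic ∧ T = u * v ∧ u.natDegree = m := by
  refine exists_monic_mul_eq_of_natDegree_le (p := p) hT
    (fun P Q hPm hP hQm hQ hdeg hQp hPT => ?_) hm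
  have hs0 : s ≠ 0 := hsT ▸ (hT.mul (hpm.pow e)).ne_zero
  have hPs : P ∣ s := hsT ▸ hPT.mul_right _
  have hpos := (multiplicity_pos_of_dvd hPs).trans_le (hs P Q hPm hP hQm hQ hdeg)
  have hQs : Q ∣ s := by
    by_contra h
    exact hpos.ne' (multiplicity_eq_zero.mpr h)
  rw [hsT] at hQs
  exact (hQ.prime.dvd_or_dvd hQs).resolve_right fun h =>
    not_dvd_of_monic_irreducible_of_ne hpm hp hQm hQ hQp (hQ.prime.dvd_of_dvd_pow h)

theorem exists_eq_mul_pow_multiplicity {s p : F[X]} (hs : s.Monic) (hpm : p.Monic)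
    (hp : Irreducible p) :
    ∃ w : F[X], w.Monic ∧ ¬ p ∣ w ∧ s = w * p ^ multiplicity p s := by
  obtain ⟨w, hw, hpw⟩ :=
    (finiteMultiplicity_of_irreducible hp hs.ne_zero).exists_eq_pow_mul_and_not_dvd
  rw [mul_comm] at hw
  exact ⟨w, (hpm.pow _).of_mul_monic_right (hw ▸ hs), hpw, hw⟩

theorem exists_eq_mul_pow_mul_pow_multiplicity {s p p' : F[X]} (hs : s.Monic) (hpm : p.Monic)
    (hp : Irreducible p) (hpm' : p'.Monic) (hp' : Irreducible p') (hpp' : ¬ p' ∣ p) :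
    ∃ w : F[X], w.Monic ∧ ¬ p ∣ w ∧ ¬ p' ∣ w ∧
      s = w * p ^ multiplicity p s * p' ^ multiplicity p' s := by
  obtain ⟨w₁, hw₁, hpw₁, hs₁⟩ := exists_eq_mul_pow_multiplicity hs hpm hp
  obtain ⟨w, hw, hpw, hw₁s⟩ := exists_eq_mul_pow_multiplicity hw₁ hpm' hp'
  have hmul : multiplicity p' s = multiplicity p' w₁ := by
    have h0 : multiplicity p' (p ^ multiplicity p s) = 0 :=
      multiplicity_eq_zero.mpr fun h => hpp' (hp'.prime.dvd_of_dvd_pow h)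
    conv_lhs => rw [hs₁]
    rw [multiplicity_mul hp'.prime
      (finiteMultiplicity_of_irreducible hp' (hs₁ ▸ hs.ne_zero)), h0, add_zero]
  refine ⟨w, hw, fun h => hpw₁ ?_, hpw, ?_⟩
  · rw [hw₁s]
    exact h.mul_right _
  · rw [hmul, mul_right_comm, ← hw₁s]
    exact hs₁

theorem IsNMaximal.multAntitone [Fintype F] {n : ℕ} {s : F[X]} (hs : IsNMaximal n s) :
    MultAntitone s := by
  induction hN : s.natDegree using Nat.strong_induction_on generalizing s with
  | _ N ih =>
    intro p p' hpm hp hpm' hp' hdeg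
    have hpp' : ¬ p' ∣ p := not_dvd_of_monic_irreducible_of_ne hpm hp hpm' hp'
      (by rintro rfl; exact hdeg.false)
    obtain ⟨w, hw, hpw, hpw', hsw⟩ :=
      exists_eq_mul_pow_mul_pow_multiplicity hs.1 hpm hp hpm' hp' hpp'
    by_contra! hab
    generalize multiplicity p s = a at hsw hab
    generalize multiplicity p' s = b at hsw hab
    obtain ⟨c, rfl⟩ : ∃ c, a = c + (b + 1) := Nat.exists_eq_add_of_le' hab
    have hmonic : ∀ i j : ℕ, (w * p ^ i * p' ^ j).Monic := fun i j =>
      (hw.mul (hpm.pow i)).mul (hpm'.pow j)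
    have hnat : ∀ i j : ℕ, (w * p ^ i * p' ^ j).natDegree =
        w.natDegree + i * p.natDegree + j * p'.natDegree := fun i j => by
      rw [(hw.mul (hpm.pow i)).natDegree_mul (hpm'.pow j), hw.natDegree_mul (hpm.pow i),
        hpm.natDegree_pow, hpm'.natDegree_pow]
    set t := w * p ^ b * p' ^ (c + (b + 1)) with ht
    have hle : PhiN n s ≤ PhiN n t := by
      rw [hsw]
      exact phiN_le_phiN_swap hpm hp.prime hpm' hp'.prime hpp' hpw hpw' hab.le hdeg.le
    have hts : t.natDegree < s.natDegree := by
      rw [hsw, hnat, hnat]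
      nlinarith
    have htm : t.Monic := hmonic _ _
    have htmax : IsNMaximal n t :=
      ⟨htm, hts.le.trans hs.2.1, fun x hx hxn => (hs.2.2 x hx hxn).trans hle⟩
    have htn : n ≤ t.natDegree := htmax.le_natDegree
    have htanti : MultAntitone t := ih _ (hN ▸ hts) htmax rfl
    have hbn : (b + 1) * p'.natDegree ≤ n := by
      obtain ⟨x, hx⟩ := hs.factorPairs_nonempty
      rw [hsw] at hx
      obtain ⟨⟨u, v, i, k, j, l⟩, ⟨-, -, -, hik, hjl, hun, hvn⟩, -⟩ :=
        (bijOn_primePairSplittings hpm hp.prime hpm' hp'.prime hpp' hpw hpw' _ _).surjOn hx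
      dsimp only at hik hjl hun hvn
      have key : ∀ {i j m : ℕ}, b + 1 ≤ i + j → m + i * p.natDegree + j * p'.natDegree ≤ n →
          (b + 1) * p'.natDegree ≤ n := fun {i j m} hij h => by
        have h1 := Nat.mul_le_mul_right p'.natDegree hij
        have h2 := Nat.mul_le_mul_left i hdeg.le
        rw [Nat.add_mul i] at h1
        omega
      rcases le_or_gt (b + 1) (i + j) with h | h
      · exact key h hun
      · exact key (i := k) (j := l) (by omega) hvn
    have htT : t = w * p ^ b * p' ^ c * p' ^ (b + 1) := by rw [ht]; ring
    have hTdeg : n - (b + 1) * p'.natDegree ≤ (w * p ^ b * p' ^ c).natDegree := by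
      rw [htT, (hmonic b c).natDegree_mul (hpm'.pow _), hpm'.natDegree_pow] at htn
      omega
    obtain ⟨y, z, hy, hz, hyz, hydeg⟩ :=
      htanti.exists_monic_mul_eq hpm' hp' (hmonic b c) htT hTdeg
    obtain ⟨j, l, y₁, z₁, hjl, hy₁, hz₁, hyz₁, rfl, rfl⟩ :=
      exists_monic_of_mul_eq_mul_pow hp'.prime hpm' hy hz hyz.symm
    obtain ⟨i, k, u, v, hik, hu, hv, huv, rfl, rfl⟩ :=
      exists_monic_of_mul_eq_mul_pow hp.prime hpm hy₁ hz₁ hyz₁.symm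
    rw [hy₁.natDegree_mul (hpm'.pow j), hu.natDegree_mul (hpm.pow i), hpm.natDegree_pow,
      hpm'.natDegree_pow] at hydeg
    have hudeg : n = u.natDegree + i * p.natDegree + (j + (b + 1)) * p'.natDegree := by
      rw [Nat.add_mul j]
      omega
    have hwdeg : w.natDegree = u.natDegree + v.natDegree := by rw [huv, hu.natDegree_mul hv]
    have hvdeg : v.natDegree + k * p.natDegree + l * p'.natDegree ≤ n := by
      have h := hts.trans_le hs.2.1
      rw [ht, hnat, ← hik, ← hjl] at h
      nlinarith
    have hlt : PhiN n s < PhiN n t := by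
      conv_lhs => rw [hsw]
      exact phiN_lt_phiN_swap hpm hp.prime hpm' hp'.prime hpp' hpw hpw' hab hdeg
        (u := u) (v := v) (i := i) (k := k) (j := j + (b + 1)) (l := l)
        ⟨hu, hv, huv, hik, by dsimp only; omega, hudeg.ge, hvdeg⟩ (by omega) hudeg
    exact hlt.not_ge (hs.2.2 t htm htmax.2.1)

theorem IsNMaximal.multiplicity_le [Fintype F] {n : ℕ} {s p : F[X]} (hs : IsNMaximal n s)
    (hpm : p.Monic) (hp : Irreducible p) (hdeg : 1 < p.natDegree) :
    multiplicity p s ≤ 2 * n - s.natDegree := by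
  obtain ⟨w, hw, hpw, hsw⟩ := exists_eq_mul_pow_multiplicity hs.1 hpm hp
  by_contra! hlt
  generalize multiplicity p s = a at hsw hlt
  obtain ⟨e, rfl⟩ := Nat.exists_eq_succ_of_ne_zero (Nat.ne_zero_of_lt hlt)
  rw [Nat.succ_eq_add_one] at hsw hlt
  have hnat : s.natDegree = w.natDegree + (e + 1) * p.natDegree := by
    rw [hsw, hw.natDegree_mul (hpm.pow _), hpm.natDegree_pow]
  obtain ⟨v, u, hv, hu, hvu, hvdeg⟩ := hs.multAntitone.exists_monic_mul_eq hpm hp hw hsw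
    (Nat.div_le_self w.natDegree 2)
  have hle := hs.2.1
  have hmul : (e + 1) * 2 ≤ (e + 1) * p.natDegree := Nat.mul_le_mul_left _ hdeg
  have hphi : PhiN n (w * p ^ (e + 1)) < PhiN n (w * p ^ e) :=
    phiN_lt_phiN_of_lt (r := 2 * n - s.natDegree) hpm hp.prime hpw (by omega) hu hv
      (by rw [hvu, mul_comm]) (by omega) (by omega)
  rw [← hsw] at hphi
  refine hphi.not_ge (hs.2.2 _ (hw.mul (hpm.pow e)) ?_)
  rw [hw.natDegree_mul (hpm.pow _), hpm.natDegree_pow]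
  rw [Nat.add_mul] at hnat
  omega

end Maximal

/-- Proposition (Props 1 for `n`-maximal polynomials): if `s ∈ P_{2n}` is `n`-maximal and
`r_0 = 2n − deg s`, then (i) multiplicities in `s` are non-increasing in the degree of the
monic irreducible, and (ii) `mult_p(s) ≤ r_0` for every monic irreducible `p` of degree
greater than 1. -/
theorem nMaximal_mult_antitone {F : Type} [Field F] [Fintype F]
    (n : ℕ) (hn : 0 < n) (s : F[X]) (hs : IsNMaximal n s) :
    (∀ p p' : F[X], p.Monic → Irreducible p → p'.Monic → Irreducible p' →
      p'.natDegree < p.natDegree → multiplicity p s ≤ multiplicity p' s) ∧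
    (∀ p : F[X], p.Monic → Irreducible p → 1 < p.natDegree →
      multiplicity p s ≤ 2 * n - s.natDegree) :=
  ⟨hs.multAntitone, fun _ => hs.multiplicity_le⟩
end

section
/- Let n be a positive integer, let s ∈ P_{2n} be n-maximal, let r_0 = 2n − deg s, and let ρ_n = ρ_n(s) = max(r_0, ρ(s)). Then: (i) for every monic irreducible polynomial p in F[x] of degree d with r = mult_p(s) (possibly r = 0), one has (ρ_n + 1)/(r + 2) ≤ d, and if r ≥ 1 then moreover d < (ρ_n + 1)/r; (ii) additionally ρ_n + 1 ≤ r_0 + 2 and r_0 < ρ_n + 1 (the case d = 1 applied to r_0). -/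
open Polynomial

/-- `ρ(s)`: the maximum multiplicity in `s` of a monic polynomial of degree 1. -/
noncomputable def rho {F : Type} [Field F] (s : F[X]) : ℕ :=
  sSup {r : ℕ | ∃ p : F[X], p.Monic ∧ p.natDegree = 1 ∧ r = multiplicity p s}

/-- `ρ_n(s) = max(2n − deg s, ρ(s))`. -/
noncomputable def rhoN {F : Type} [Field F] (n : ℕ) (s : F[X]) : ℕ :=
  max (2 * n - s.natDegree) (rho s)


namespace WeightedConfig

theorem geom_add (a b : ℕ) : ∑ k ∈ Finset.range (a + b), (X : ℕ[X]) ^ k =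
    ∑ k ∈ Finset.range a, X ^ k + X ^ a * ∑ k ∈ Finset.range b, X ^ k := by
  simp [Finset.sum_range_add, Finset.mul_sum, pow_add]

theorem geom_mul (d r : ℕ) : ∑ k ∈ Finset.range (d * r), (X : ℕ[X]) ^ k =
    (∑ k ∈ Finset.range r, X ^ (d * k)) * ∑ k ∈ Finset.range d, X ^ k := by
  induction r with
  | zero => simp
  | succ r ih => rw [Nat.mul_succ, geom_add, ih, Finset.sum_range_succ]; ring

theorem geom_mul_geom_succ (d r c : ℕ) :
    (∑ k ∈ Finset.range (d * (r + 1) + c), (X : ℕ[X]) ^ k) *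
        ∑ k ∈ Finset.range (r + 2), X ^ (d * k) =
      (∑ k ∈ Finset.range (d * (r + 2) + c), X ^ k) * ∑ k ∈ Finset.range (r + 1), X ^ (d * k) +
        X ^ (d * (r + 1)) * ∑ k ∈ Finset.range c, X ^ k := by
  have h : ∑ k ∈ Finset.range (r + 2), (X : ℕ[X]) ^ (d * k) =
      X ^ d * (∑ k ∈ Finset.range (r + 1), X ^ (d * k)) + 1 := by
    rw [Finset.sum_range_succ', Finset.mul_sum]
    simp [mul_add, pow_add, mul_comm]
  rw [geom_add, geom_add, geom_mul, geom_mul]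
  have e : (X : ℕ[X]) ^ (d * (r + 2)) = X ^ (d * (r + 1)) * X ^ d := by ring
  rw [e, h]
  ring

theorem geom_mul_geom_pred {d r L c : ℕ} (h : d * r = L + c) :
    (∑ k ∈ Finset.range (L + d), (X : ℕ[X]) ^ k) * ∑ k ∈ Finset.range r, X ^ (d * k) =
      (∑ k ∈ Finset.range L, X ^ k) * ∑ k ∈ Finset.range (r + 1), X ^ (d * k) +
        X ^ L * ∑ k ∈ Finset.range c, X ^ k := by
  have h1 := geom_mul d r
  rw [h, add_comm L c, geom_add] at h1
  rw [geom_add, Finset.sum_range_succ, add_mul, mul_assoc,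
    mul_comm (∑ k ∈ Finset.range d, (X : ℕ[X]) ^ k), ← h1, h]
  ring

variable {ι : Type*}

theorem exists_add_single_add_single {i j : ι} (hij : i ≠ j) (m : ι →₀ ℕ) :
    ∃ R : ι →₀ ℕ, R i = 0 ∧ R j = 0 ∧
      m = R + Finsupp.single j (m j) + Finsupp.single i (m i) := by
  refine ⟨(m.erase i).erase j, ?_, by simp, ?_⟩
  · simp [Finsupp.erase_ne hij]
  · have h := Finsupp.erase_add_single j (m.erase i)
    rw [Finsupp.erase_ne hij.symm] at h
    rw [h, Finsupp.erase_add_single]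

theorem le_weight {d : ι → ℕ} {i : ι} (hi : d i = 1) (m : ι →₀ ℕ) : m i ≤ Finsupp.weight d m := by
  conv_rhs => rw [← Finsupp.single_add_erase i m]
  simp [Finsupp.weight_single, hi]

variable [DecidableEq ι] (d : ι → ℕ)

/-- The generating polynomial of the weights of all `k ≤ m`. -/
noncomputable def gen (m : ι →₀ ℕ) : ℕ[X] :=
  ∑ k ∈ Finset.Iic m, X ^ Finsupp.weight d k

/-- `m` has weight `2n` and maximises, among those, the number of `k ≤ m` of weight `n`. -/
def IsMaximal (n : ℕ) (m : ι →₀ ℕ) : Prop :=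
  Finsupp.weight d m = 2 * n ∧
    ∀ m', Finsupp.weight d m' = 2 * n → (gen d m').coeff n ≤ (gen d m).coeff n

theorem coeff_gen (m : ι →₀ ℕ) (n : ℕ) :
    (gen d m).coeff n = (Finset.filter (fun k => Finsupp.weight d k = n) (Finset.Iic m)).card := by
  simp [gen, finsetSum_coeff, coeff_X_pow, eq_comm]

theorem gen_add_single {m : ι →₀ ℕ} {i : ι} (hm : m i = 0) (a : ℕ) :
    gen d (m + Finsupp.single i a) = gen d m * ∑ k ∈ Finset.range (a + 1), X ^ (d i * k) := by
  rw [gen, gen, Finset.sum_mul_sum, ← Finset.sum_product']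
  refine Finset.sum_nbij' (fun k => (k.erase i, k i)) (fun p => p.1 + Finsupp.single i p.2)
    ?_ ?_ ?_ ?_ ?_
  · intro k hk
    rw [Finset.mem_Iic] at hk
    simp only [Finset.mem_product, Finset.mem_Iic, Finset.mem_range]
    refine ⟨fun x => ?_, ?_⟩
    · have := hk x
      by_cases hx : x = i
      · simp [hx]
      · simpa [Finsupp.erase_ne hx, Finsupp.single_apply, Ne.symm hx] using this
    · have := hk i
      simp [hm] at this
      omega
  · rintro ⟨k, b⟩ hk
    simp only [Finset.mem_product, Finset.mem_Iic, Finset.mem_range] at hk ⊢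
    exact add_le_add hk.1 (Finsupp.single_le_single.2 (by omega))
  · intro k _
    exact Finsupp.erase_add_single i k
  · rintro ⟨k, b⟩ hk
    simp only [Finset.mem_product, Finset.mem_Iic, Finset.mem_range] at hk
    have : k i = 0 := by have := hk.1 i; omega
    ext x
    · by_cases hx : x = i
      · simp [hx, this]
      · simp [Finsupp.erase_ne hx]
    · simp [this]
  · intro k _
    rw [← pow_add]
    conv_lhs => rw [← Finsupp.erase_add_single i k]
    simp [Finsupp.weight_single, mul_comm]

variable {d}

theorem gen_add_single_add_single {R : ι →₀ ℕ} {i j : ι} (hij : i ≠ j) (hi : d i = 1)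
    (hRi : R i = 0) (hRj : R j = 0) (a b : ℕ) :
    gen d (R + Finsupp.single j b + Finsupp.single i a) =
      gen d R * ((∑ k ∈ Finset.range (a + 1), X ^ k) *
        ∑ k ∈ Finset.range (b + 1), X ^ (d j * k)) := by
  rw [gen_add_single d (by simp [hRi, hij.symm]), gen_add_single d hRj]
  simp only [hi, one_mul]
  ring

/-- Trading one unit at `j` for `d j` units at `i` preserves maximality when `j` is heavy. -/
theorem IsMaximal.exists_trade {n : ℕ} {m : ι →₀ ℕ} (hm : IsMaximal d n m) {i j : ι}
    (hij : i ≠ j) (hi : d i = 1) (h : m i + 1 ≤ d j * m j) :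
    ∃ m', IsMaximal d n m' ∧ m' i = m i + d j ∧ ∀ l, l ≠ i → l ≠ j → m' l = m l := by
  obtain ⟨R, hRi, hRj, hR⟩ := exists_add_single_add_single hij m
  obtain ⟨r, hr⟩ : ∃ r, m j = r + 1 :=
    Nat.exists_eq_succ_of_ne_zero (by rintro h0; simp [h0] at h)
  obtain ⟨c, hc⟩ := Nat.exists_eq_add_of_le h
  have hw : Finsupp.weight d (R + Finsupp.single j r + Finsupp.single i (m i + d j)) = 2 * n := by
    rw [← hm.1]
    conv_rhs => rw [hR]
    simp only [map_add, Finsupp.weight_single, hi, hr, smul_eq_mul]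
    ring
  refine ⟨R + Finsupp.single j r + Finsupp.single i (m i + d j), ⟨hw, fun m' hm' => ?_⟩, ?_, ?_⟩
  · refine (hm.2 m' hm').trans ?_
    conv_lhs => rw [hR]
    rw [gen_add_single_add_single hij hi hRi hRj, gen_add_single_add_single hij hi hRi hRj,
      show m i + d j + 1 = m i + 1 + d j by ring, ← hr, geom_mul_geom_pred hc, mul_add, coeff_add]
    exact Nat.le_add_right _ _
  · simp [hRi, hij.symm]
  · intro l hli hlj
    rw [hR]
    simp [Finsupp.single_apply, hli.symm, hlj.symm]

/-- If every weight in `R` is at most `R l + 1`, where `l` has weight `1`, then all values up to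
the weight of `R` are weights of some `k ≤ R`. -/
theorem exists_le_weight_eq {l : ι} (hl : d l = 1) (R : ι →₀ ℕ)
    (hR : ∀ j, R j ≠ 0 → d j ≤ R l + 1) {e : ℕ} (he : e ≤ Finsupp.weight d R) :
    ∃ k ≤ R, Finsupp.weight d k = e := by
  have key : ∀ (N t : ℕ) (Q : ι →₀ ℕ), Finsupp.degree Q = N → (∀ j, Q j ≠ 0 → d j ≤ t + 1) →
      ∀ e ≤ Finsupp.weight d (Finsupp.single l t + Q),
        ∃ k ≤ Finsupp.single l t + Q, Finsupp.weight d k = e := by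
    intro N
    induction N with
    | zero =>
      intro t Q hQ _ e he
      rw [Finsupp.degree_eq_zero_iff] at hQ
      subst hQ
      refine ⟨Finsupp.single l e, ?_, by simp [Finsupp.weight_single, hl]⟩
      rw [add_zero] at he ⊢
      exact Finsupp.single_le_single.2 (by simpa [Finsupp.weight_single, hl] using he)
    | succ N ih =>
      intro t Q hQ hd e he
      obtain ⟨j, hj⟩ : ∃ j, Q j ≠ 0 := by
        by_contra! h
        have : Q = 0 := Finsupp.ext h
        simp [this] at hQ
      have hle : Finsupp.single j 1 ≤ Q := by
        rw [Finsupp.single_le_iff]; omega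
      obtain ⟨Q', rfl⟩ := exists_add_of_le hle
      have hdeg : Finsupp.degree Q' = N := by
        simp [Finsupp.degree_single] at hQ; omega
      have ih' := ih t Q' hdeg (fun x hx => hd x (by simp; omega))
      have hdj := hd j hj
      have hwt : Finsupp.weight d (Finsupp.single l t + (Finsupp.single j 1 + Q')) =
          Finsupp.weight d (Finsupp.single l t + Q') + d j := by
        simp [Finsupp.weight_single]; ring
      have hle' : t ≤ Finsupp.weight d (Finsupp.single l t + Q') := by
        simp [Finsupp.weight_single, hl]
      rw [add_left_comm]
      rw [hwt] at he
      by_cases hlt : e ≤ Finsupp.weight d (Finsupp.single l t + Q')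
      · obtain ⟨k, hk, hke⟩ := ih' e hlt
        exact ⟨k, hk.trans le_add_self, hke⟩
      · obtain ⟨k, hk, hke⟩ := ih' (e - d j) (by omega)
        refine ⟨Finsupp.single j 1 + k, add_le_add le_rfl hk, ?_⟩
        simp [Finsupp.weight_single, hke]
        omega
  have hdec : Finsupp.single l (R l) + R.erase l = R := Finsupp.single_add_erase l R
  have := key _ (R l) (R.erase l) rfl (fun j hj => hR j (by
    rintro h0
    by_cases hjl : j = l
    · simp [hjl] at hj
    · simp [Finsupp.erase_ne hjl, h0] at hj)) e (by rwa [hdec])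
  rwa [hdec] at this

theorem coeff_gen_pos {R k : ι →₀ ℕ} (hk : k ≤ R) : 0 < (gen d R).coeff (Finsupp.weight d k) := by
  rw [coeff_gen, Finset.card_pos]
  exact ⟨k, by simp [hk]⟩

theorem IsMaximal.lt_of_forall_le {n : ℕ} {m : ι →₀ ℕ} (hm : IsMaximal d n m) {i j l : ι}
    (hij : i ≠ j) (hli : l ≠ i) (hlj : l ≠ j) (hi : d i = 1) (hl : d l = 1)
    (h : ∀ p, p ≠ i → p ≠ j → m p ≠ 0 → d p ≤ m l + 1) : m i < d j * (m j + 2) := by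
  by_contra! hc
  obtain ⟨R, hRi, hRj, hR⟩ := exists_add_single_add_single hij m
  obtain ⟨c, hc⟩ := Nat.exists_eq_add_of_le hc
  have hRp : ∀ p, p ≠ i → p ≠ j → R p = m p := fun p hpi hpj => by
    rw [hR]; simp [hpi.symm, hpj.symm]
  have hwm : Finsupp.weight d R + m j * d j + m i = 2 * n := by
    rw [← hm.1]
    conv_rhs => rw [hR]
    simp [Finsupp.weight_single, hi]
  obtain ⟨k, hk, hke⟩ := exists_le_weight_eq hl R (fun p hp => by
    have hpi : p ≠ i := by rintro rfl; exact hp hRi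
    have hpj : p ≠ j := by rintro rfl; exact hp hRj
    rw [hRp l hli hlj]
    exact h p hpi hpj (by rwa [← hRp p hpi hpj])) (Nat.div_le_self (Finsupp.weight d R) 2)
  have e1 : d j * (m j + 2) = m j * d j + 2 * d j := by ring
  have e2 : d j * (m j + 1) = m j * d j + d j := by ring
  have hw : Finsupp.weight d (R + Finsupp.single j (m j + 1) +
      Finsupp.single i (d j * (m j + 1) + c)) = 2 * n := by
    simp only [map_add, Finsupp.weight_single, hi, smul_eq_mul, add_mul]
    omega
  have hle := hm.2 _ hw
  conv_rhs at hle => rw [hR]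
  rw [gen_add_single_add_single hij hi hRi hRj, gen_add_single_add_single hij hi hRi hRj, hc,
    add_assoc _ c 1, add_assoc _ c 1, geom_mul_geom_succ, mul_add, coeff_add] at hle
  have hpos : 0 < (gen d R * (X ^ (d j * (m j + 1)) *
      ∑ k ∈ Finset.range (c + 1), X ^ k)).coeff n := by
    have hn : (n - Finsupp.weight d R / 2 - d j * (m j + 1) + d j * (m j + 1),
        Finsupp.weight d R / 2) ∈ Finset.HasAntidiagonal.antidiagonal n := by
      rw [Finset.HasAntidiagonal.mem_antidiagonal]
      omega
    rw [mul_comm, coeff_mul]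
    refine lt_of_lt_of_le ?_ (Finset.single_le_sum (fun _ _ => Nat.zero_le _) hn)
    refine Nat.mul_pos ?_ (hke ▸ coeff_gen_pos hk)
    rw [mul_comm, coeff_mul_X_pow]
    simp only [finsetSum_coeff, coeff_X_pow, Finset.sum_ite_eq, Finset.mem_range]
    rw [if_pos (by omega)]
    exact Nat.one_pos
  omega

/-- In a maximal configuration, an index of weight `1` cannot have a multiplicity much larger
than the multiplicity of another index. -/
theorem IsMaximal.lt_mul {n : ℕ} {m : ι →₀ ℕ} (hm : IsMaximal d n m) {i j l : ι}
    (hij : i ≠ j) (hli : l ≠ i) (hlj : l ≠ j) (hi : d i = 1) (hl : d l = 1) :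
    m i < d j * (m j + 2) := by
  induction hN : 2 * n - m l using Nat.strong_induction_on generalizing m with
  | _ N ih =>
    by_cases h : ∀ p, p ≠ i → p ≠ j → m p ≠ 0 → d p ≤ m l + 1
    · exact hm.lt_of_forall_le hij hli hlj hi hl h
    · push Not at h
      obtain ⟨p, hpi, hpj, hp, hd⟩ := h
      have hpl : l ≠ p := by rintro rfl; omega
      have h1 : d p ≤ d p * m p := Nat.le_mul_of_pos_right _ (Nat.pos_of_ne_zero hp)
      obtain ⟨m', hm', h2, h3⟩ := hm.exists_trade hpl hl (by omega)
      have h4 := le_weight hl m'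
      rw [hm'.1] at h4
      have := ih (2 * n - m' l) (by omega) hm' rfl
      rwa [h3 i hli.symm hpi.symm, h3 j hlj.symm hpj.symm] at this

theorem IsMaximal.bounds {n : ℕ} {m : ι →₀ ℕ} (hm : IsMaximal d n m) (hd : ∀ j, 0 < d j)
    (h3 : ∀ i j, ∃ l, l ≠ i ∧ l ≠ j ∧ d l = 1) {i : ι} (hi : d i = 1)
    (hmax : ∀ l, d l = 1 → m l ≤ m i) (j : ι) :
    m i + 1 ≤ d j * (m j + 2) ∧ d j * m j ≤ m i := by
  constructor
  · by_cases hij : i = j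
    · subst hij; rw [hi]; omega
    · obtain ⟨l, hli, hlj, hl⟩ := h3 i j
      exact hm.lt_mul hij hli hlj hi hl
  · by_contra! hlt
    have hdj : d j ≠ 1 := fun h => by
      have := hmax j h
      rw [h] at hlt
      omega
    have hij : i ≠ j := by rintro rfl; exact hdj hi
    obtain ⟨m', hm', h1, h2⟩ := hm.exists_trade hij hi hlt
    obtain ⟨l, hli, hlj, hl⟩ := h3 i j
    obtain ⟨k, hki, hkl, hk⟩ := h3 i l
    have h4 := hm'.lt_mul hli.symm hki hkl hi hk
    rw [h1, h2 l hli hlj, hl] at h4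
    have := hmax l hl
    have := hd j
    omega

end WeightedConfig
namespace MonicFactorization

variable {F : Type} [Field F]

/-- The monic irreducible polynomials, together with the place at infinity `none`. -/
abbrev Place (F : Type) [Field F] : Type := Option {p : F[X] // p.Monic ∧ Irreducible p}

/-- The degree of a place; the place at infinity has degree `1`. -/
noncomputable def placeDegree : Place F → ℕ
  | none => 1
  | some p => p.1.natDegree

/-- The monic polynomial with the given multiplicities at the finite places. -/
noncomputable def toPoly (m : Place F →₀ ℕ) : F[X] := m.some.prod fun p a => p.1 ^ a

theorem toPoly_zero : toPoly (0 : Place F →₀ ℕ) = 1 := by simp [toPoly]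

theorem toPoly_add (m m' : Place F →₀ ℕ) : toPoly (m + m') = toPoly m * toPoly m' := by
  rw [toPoly, Finsupp.some_add]
  exact Finsupp.prod_add_index' (fun _ => pow_zero _) fun _ _ _ => pow_add _ _ _

theorem toPoly_single_none (a : ℕ) : toPoly (Finsupp.single (none : Place F) a) = 1 := by
  simp [toPoly]

theorem toPoly_single_some (p : {p : F[X] // p.Monic ∧ Irreducible p}) (a : ℕ) :
    toPoly (Finsupp.single (some p : Place F) a) = p.1 ^ a := by
  simp [toPoly]

theorem toPoly_monic (m : Place F →₀ ℕ) : (toPoly m).Monic :=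
  monic_prod_of_monic _ _ fun p _ => p.2.1.pow _

theorem weight_eq (m : Place F →₀ ℕ) :
    Finsupp.weight placeDegree m = m none + (toPoly m).natDegree := by
  induction m using Finsupp.induction_linear with
  | zero => simp [toPoly_zero]
  | add f g hf hg =>
    rw [map_add, hf, hg, toPoly_add, (toPoly_monic f).natDegree_mul (toPoly_monic g),
      Finsupp.add_apply]
    ring
  | single i a =>
    cases i with
    | none => simp [toPoly_single_none, Finsupp.weight_single, placeDegree]
    | some p => simp [toPoly_single_some, Finsupp.weight_single, placeDegree]

theorem emultiplicity_toPoly (p : {p : F[X] // p.Monic ∧ Irreducible p}) (m : Place F →₀ ℕ) :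
    emultiplicity p.1 (toPoly m) = m (some p) := by
  induction m using Finsupp.induction_linear with
  | zero => simp [toPoly_zero, emultiplicity_eq_zero, ← isUnit_iff_dvd_one, p.2.2.not_isUnit]
  | add f g hf hg => simp [toPoly_add, emultiplicity_mul p.2.2.prime, hf, hg]
  | single i a =>
    cases i with
    | none =>
      simp [toPoly_single_none, emultiplicity_eq_zero, ← isUnit_iff_dvd_one, p.2.2.not_isUnit]
    | some r =>
      rw [toPoly_single_some]
      by_cases h : r = p
      · subst h
        simp [emultiplicity_pow_self r.2.2.ne_zero r.2.2.not_isUnit]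
      · have h' : (some r : Place F) ≠ some p := by simpa using h
        rw [Finsupp.single_eq_of_ne' h', Nat.cast_zero, emultiplicity_eq_zero]
        intro hdvd
        exact h (Subtype.ext (eq_of_monic_of_associated r.2.1 p.2.1
          (p.2.2.associated_of_dvd r.2.2 (p.2.2.prime.dvd_of_dvd_pow hdvd)).symm))

theorem multiplicity_toPoly (p : {p : F[X] // p.Monic ∧ Irreducible p}) (m : Place F →₀ ℕ) :
    multiplicity p.1 (toPoly m) = m (some p) :=
  multiplicity_eq_of_emultiplicity_eq_some (emultiplicity_toPoly p m)

theorem ext_toPoly {m m' : Place F →₀ ℕ} (h : m none = m' none) (h' : toPoly m = toPoly m') :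
    m = m' := by
  ext i
  cases i with
  | none => exact h
  | some p => rw [← multiplicity_toPoly, h', multiplicity_toPoly]

theorem exists_toPoly_eq {s : F[X]} (hs : s.Monic) (a : ℕ) :
    ∃ m : Place F →₀ ℕ, m none = a ∧ toPoly m = s := by
  induction hN : s.natDegree using Nat.strong_induction_on generalizing s with
  | _ N ih =>
    by_cases hu : IsUnit s
    · exact ⟨Finsupp.single none a, by simp, by
        rw [toPoly_single_none, hs.eq_one_of_isUnit hu]⟩
    · obtain ⟨p, hp, hirr, t, rfl⟩ := exists_monic_irreducible_factor s hu
      have ht := hp.of_mul_monic_left hs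
      have hdeg := hirr.natDegree_pos
      rw [hp.natDegree_mul ht] at hN
      obtain ⟨m, hm, rfl⟩ := ih t.natDegree (by omega) ht rfl
      exact ⟨Finsupp.single (some ⟨p, hp, hirr⟩) 1 + m, by simp [hm], by
        rw [toPoly_add, toPoly_single_some, pow_one]⟩

open Classical in
theorem phiN_toPoly {n : ℕ} {m : Place F →₀ ℕ} (hm : Finsupp.weight placeDegree m = 2 * n) :
    PhiN n (toPoly m) = (WeightedConfig.gen placeDegree m).coeff n := by
  rw [WeightedConfig.coeff_gen, ← Set.ncard_coe_finset, PhiN]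
  symm
  refine Set.ncard_congr (fun k _ => (toPoly k, toPoly (m - k))) ?_ ?_ ?_
  · intro k hk
    simp only [Finset.coe_filter, Finset.mem_Iic, Set.mem_ofPred_eq] at hk
    obtain ⟨hk, hw⟩ := hk
    have hadd := add_tsub_cancel_of_le hk
    have h1 := weight_eq k
    have h2 := weight_eq (m - k)
    have h3 : Finsupp.weight placeDegree k + Finsupp.weight placeDegree (m - k) = 2 * n := by
      rw [← map_add, hadd, hm]
    refine ⟨toPoly_monic _, ?_, toPoly_monic _, ?_, ?_⟩
    · dsimp only; omega
    · dsimp only; omega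
    · rw [← toPoly_add, hadd]
  · intro k k' hk hk' h
    simp only [Finset.coe_filter, Finset.mem_Iic, Set.mem_ofPred_eq] at hk hk'
    have h1 := (Prod.mk.inj h).1
    have h2 := weight_eq k
    have h3 := weight_eq k'
    rw [h1] at h2
    exact ext_toPoly (by omega) h1
  · rintro ⟨u, v⟩ ⟨hu, hun, hv, hvn, huv⟩
    dsimp only at hu hun hv hvn huv
    obtain ⟨k, hk, rfl⟩ := exists_toPoly_eq hu (n - u.natDegree)
    obtain ⟨k', hk', rfl⟩ := exists_toPoly_eq hv (n - v.natDegree)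
    have hmw := weight_eq m
    rw [huv, (toPoly_monic k).natDegree_mul (toPoly_monic k')] at hmw
    have hkk : m = k + k' := ext_toPoly (by rw [Finsupp.add_apply]; omega) (by
      rw [huv, toPoly_add])
    have hkw := weight_eq k
    refine ⟨k, ?_, ?_⟩
    · simp only [Finset.coe_filter, Finset.mem_Iic, Set.mem_ofPred_eq]
      exact ⟨hkk ▸ le_self_add, by omega⟩
    · rw [hkk, add_tsub_cancel_left]

open Classical in
theorem isMaximal_of_isNMaximal {n : ℕ} {m : Place F →₀ ℕ}
    (hm : Finsupp.weight placeDegree m = 2 * n) (h : IsNMaximal n (toPoly m)) :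
    WeightedConfig.IsMaximal placeDegree n m := by
  refine ⟨hm, fun m' hm' => ?_⟩
  rw [← phiN_toPoly hm, ← phiN_toPoly hm']
  exact h.2.2 _ (toPoly_monic m') (by have := weight_eq m'; omega)

theorem placeDegree_pos (j : Place F) : 0 < placeDegree j := by
  cases j with
  | none => exact Nat.one_pos
  | some p => exact p.2.2.natDegree_pos

theorem irreducible_of_natDegree_eq_one {p : F[X]} (h : p.natDegree = 1) : Irreducible p :=
  irreducible_of_degree_eq_one ((degree_eq_iff_natDegree_eq_of_pos Nat.one_pos).2 h)

theorem exists_placeDegree_eq_one (i j : Place F) : ∃ l, l ≠ i ∧ l ≠ j ∧ placeDegree l = 1 := by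
  let P (a : F) : Place F := some ⟨X - C a, monic_X_sub_C a, irreducible_X_sub_C a⟩
  have hP (a : F) : placeDegree (P a) = 1 := natDegree_X_sub_C a
  have hne : P 0 ≠ P 1 := fun h => by
    have := congrArg (fun p : {p : F[X] // p.Monic ∧ Irreducible p} => p.1) (Option.some.inj h)
    exact zero_ne_one (C_injective (sub_right_injective this))
  have hnone (a : F) : none ≠ P a := nofun
  by_cases h0 : (none : Place F) ≠ i ∧ none ≠ j
  · exact ⟨none, h0.1, h0.2, rfl⟩
  by_cases h1 : P 0 ≠ i ∧ P 0 ≠ j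
  · exact ⟨P 0, h1.1, h1.2, hP 0⟩
  refine ⟨P 1, ?_, ?_, hP 1⟩
  · grind
  · grind

/-- The multiplicities of the linear polynomials in `toPoly m` are bounded by `rho`, which is
attained. -/
theorem isGreatest_rho (m : Place F →₀ ℕ) :
    IsGreatest {r : ℕ | ∃ p : F[X], p.Monic ∧ p.natDegree = 1 ∧
      r = multiplicity p (toPoly m)} (rho (toPoly m)) := by
  have hb : BddAbove {r : ℕ | ∃ p : F[X], p.Monic ∧ p.natDegree = 1 ∧
      r = multiplicity p (toPoly m)} := by
    refine ⟨(toPoly m).natDegree, ?_⟩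
    rintro _ ⟨p, hp, hp1, rfl⟩
    have := natDegree_le_of_dvd (pow_multiplicity_dvd p (toPoly m)) (toPoly_monic m).ne_zero
    rwa [hp.natDegree_pow, hp1, mul_one] at this
  exact ⟨Nat.sSup_mem ⟨_, X, monic_X, natDegree_X, rfl⟩ hb, fun _ h => le_csSup hb h⟩

theorem exists_eq_rhoN {n : ℕ} {m : Place F →₀ ℕ} (hm : Finsupp.weight placeDegree m = 2 * n) :
    ∃ i, placeDegree i = 1 ∧ m i = rhoN n (toPoly m) ∧
      ∀ l, placeDegree l = 1 → m l ≤ m i := by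
  have hw := weight_eq m
  have h0 : 2 * n - (toPoly m).natDegree = m none := by omega
  have hle : ∀ l, placeDegree l = 1 → m l ≤ rhoN n (toPoly m) := by
    intro l hl
    rw [rhoN, h0]
    cases l with
    | none => exact le_max_left _ _
    | some p =>
      exact le_max_of_le_right ((isGreatest_rho m).2 ⟨p.1, p.2.1, hl, by
        rw [multiplicity_toPoly]⟩)
  obtain ⟨i, hi, hmi⟩ : ∃ i, placeDegree i = 1 ∧ m i = rhoN n (toPoly m) := by
    rw [rhoN, h0]
    rcases max_choice (m none) (rho (toPoly m)) with h | h
    · exact ⟨none, rfl, h.symm⟩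
    · obtain ⟨p, hp, hp1, hr⟩ := (isGreatest_rho m).1
      refine ⟨some ⟨p, hp, irreducible_of_natDegree_eq_one hp1⟩, hp1, ?_⟩
      rw [h, hr, ← multiplicity_toPoly]
  exact ⟨i, hi, hmi, fun l hl => hmi ▸ hle l hl⟩

end MonicFactorization

/-- Proposition 5: let `s ∈ P_{2n}` be `n`-maximal, `r_0 = 2n − deg s`,
`ρ_n = max(r_0, ρ(s))`. Then (i) for every monic irreducible `p` of degree `d` with
`r = mult_p(s)` one has `(ρ_n+1)/(r+2) ≤ d`, and `d < (ρ_n+1)/r` when `r ≥ 1`; and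
(ii) `ρ_n + 1 ≤ r_0 + 2` and `r_0 < ρ_n + 1`. -/
theorem nMaximal_mult_degree_bounds {F : Type} [Field F] [Fintype F]
    (n : ℕ) (hn : 0 < n) (s : F[X]) (hs : IsNMaximal n s) :
    (∀ p : F[X], p.Monic → Irreducible p →
      ((rhoN n s : ℝ) + 1) / ((multiplicity p s : ℝ) + 2) ≤ (p.natDegree : ℝ) ∧
      (1 ≤ multiplicity p s →
        (p.natDegree : ℝ) < ((rhoN n s : ℝ) + 1) / (multiplicity p s : ℝ))) ∧
    rhoN n s + 1 ≤ (2 * n - s.natDegree) + 2 ∧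
    2 * n - s.natDegree < rhoN n s + 1 := by
  classical
  obtain ⟨hsm, hdeg, -⟩ := id hs
  obtain ⟨m, hm0, rfl⟩ := MonicFactorization.exists_toPoly_eq hsm (2 * n - s.natDegree)
  have hm : Finsupp.weight MonicFactorization.placeDegree m = 2 * n := by
    rw [MonicFactorization.weight_eq]
    omega
  obtain ⟨i, hi, hmi, hmax⟩ := MonicFactorization.exists_eq_rhoN hm
  have key := (MonicFactorization.isMaximal_of_isNMaximal hm hs).bounds
    MonicFactorization.placeDegree_pos MonicFactorization.exists_placeDegree_eq_one hi hmax
  rw [hmi] at key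
  refine ⟨fun p hp hirr => ?_, ?_, ?_⟩
  · obtain ⟨h1, h2⟩ := key (some ⟨p, hp, hirr⟩)
    rw [← MonicFactorization.multiplicity_toPoly] at h1 h2
    change _ ≤ p.natDegree * (multiplicity p _ + 2) at h1
    change p.natDegree * multiplicity p _ ≤ _ at h2
    refine ⟨?_, fun hpos => ?_⟩
    · rw [div_le_iff₀ (by positivity)]
      exact_mod_cast h1
    · rw [lt_div_iff₀ (by exact_mod_cast hpos)]
      exact_mod_cast Nat.lt_succ_of_le h2
  · have h := (key none).1
    rw [← hm0]
    change _ ≤ 1 * (m none + 2) at h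
    omega
  · exact Nat.lt_succ_of_le (le_max_left _ _)
end

section
/- Let n be a positive integer and let s ∈ P_{2n} be n-maximal with ρ_n(s) = 2n − deg s. Let p be a monic irreducible polynomial in F[x] of degree d, let r = mult_p(s), and set h = (2n − deg s) + r·d. Then the polynomial a = s / p^r has a monic divisor of degree exactly n − ⌊h/2⌋. -/
open Polynomial

/-- The geometric sum `1 + X^d + ⋯ + X^{d(m-1)}`. -/
noncomputable def geomPoly (d m : ℕ) : ℕ[X] := ∑ i ∈ Finset.range m, (X ^ d) ^ i

theorem geomPoly_add (d a b : ℕ) :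
    geomPoly d (a + b) = geomPoly d a + (X ^ d) ^ a * geomPoly d b := by
  simp only [geomPoly, Finset.sum_range_add, Finset.mul_sum, pow_add]

theorem geomPoly_mul_geomPoly_one (d r : ℕ) :
    geomPoly d r * geomPoly 1 d = geomPoly 1 (r * d) := by
  induction r with
  | zero => simp [geomPoly]
  | succ r ih =>
    rw [geomPoly_add, add_mul, ih, Nat.succ_mul, geomPoly_add]
    simp only [geomPoly, Finset.range_one, Finset.sum_singleton, pow_zero, mul_one, pow_one]
    rw [← pow_mul, mul_comm r d]

/-- Moving one factor of degree `d` from a place of degree `d` to a place of degree one. -/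
theorem geomPoly_exchange (d r e : ℕ) (h : e + 1 ≤ r * d) :
    geomPoly d r * geomPoly 1 (e + 1 + d) =
      geomPoly d (r + 1) * geomPoly 1 (e + 1) + ∑ t ∈ Finset.Ico (e + 1) (r * d), X ^ t := by
  have h1 : geomPoly 1 (r * d) = geomPoly 1 (e + 1) + ∑ t ∈ Finset.Ico (e + 1) (r * d), X ^ t := by
    simp only [geomPoly, pow_one]
    rw [Finset.sum_range_add_sum_Ico _ h]
  have h2 : geomPoly 1 (e + 1) + X ^ (e + 1) * geomPoly 1 (r * d) =
      geomPoly 1 (r * d) + X ^ (r * d) * geomPoly 1 (e + 1) := by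
    have := geomPoly_add 1 (e + 1) (r * d)
    rw [add_comm (e + 1), geomPoly_add] at this
    simpa using this.symm
  have h3 : geomPoly d (r + 1) = geomPoly d r + X ^ (r * d) := by
    rw [geomPoly_add]; simp [geomPoly, ← pow_mul, mul_comm r d]
  suffices h4 : geomPoly 1 (e + 1) + geomPoly d r * geomPoly 1 (e + 1 + d) =
      geomPoly 1 (e + 1) + (geomPoly d (r + 1) * geomPoly 1 (e + 1) +
        ∑ t ∈ Finset.Ico (e + 1) (r * d), X ^ t) by
    ext i
    have := congrArg (fun f => coeff f i) h4
    simpa only [coeff_add, Nat.add_left_cancel_iff] using this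
  rw [geomPoly_add 1 (e + 1) d, h3, mul_add, pow_one, mul_left_comm, geomPoly_mul_geomPoly_one]
  calc _ = geomPoly d r * geomPoly 1 (e + 1) +
        (geomPoly 1 (e + 1) + X ^ (e + 1) * geomPoly 1 (r * d)) := by ring
    _ = _ := by rw [h2, h1]; ring

section

variable {F : Type} [Field F]

theorem irreducible_of_monic_linear {l : F[X]} (hl : l.Monic) (hl1 : l.natDegree = 1) :
    Irreducible l :=
  irreducible_of_degree_eq_one (by rw [degree_eq_natDegree hl.ne_zero, hl1]; rfl)

theorem not_dvd_of_ne {l p : F[X]} (hl : l.Monic) (hli : Irreducible l) (hp : p.Monic)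
    (hpi : Irreducible p) (h : l ≠ p) : ¬ l ∣ p := fun h' =>
  h (eq_of_monic_of_associated hl hp ((hli.dvd_irreducible_iff_associated hpi).1 h'))

/-- The set of monic divisors of a polynomial. -/
def monicDivisors (s : F[X]) : Set F[X] := {u | u.Monic ∧ u ∣ s}

theorem monicDivisors_finite {s : F[X]} (hs : s ≠ 0) : (monicDivisors s).Finite := by
  have : Fintype (monicDivisors s) := Polynomial.fintypeSubtypeMonicDvd s hs
  exact Set.toFinite _

/-- The generating function of the monic divisors of `s` by degree. -/
noncomputable def divisorPoly (s : F[X]) : ℕ[X] :=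
  ∑ᶠ u ∈ monicDivisors s, X ^ u.natDegree

theorem divisorPoly_eq_sum {s : F[X]} (hs : s ≠ 0) :
    divisorPoly s = ∑ u ∈ (monicDivisors_finite hs).toFinset, X ^ u.natDegree :=
  finsum_mem_eq_finite_toFinset_sum _ _

theorem divisorPoly_pow_mul {p R : F[X]} (hp : p.Monic) (hirr : Irreducible p) (hR : R ≠ 0)
    (hpR : ¬ p ∣ R) (r : ℕ) :
    divisorPoly (p ^ r * R) = geomPoly p.natDegree (r + 1) * divisorPoly R := by
  have hne : p ^ r * R ≠ 0 := mul_ne_zero (pow_ne_zero _ hp.ne_zero) hR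
  rw [divisorPoly_eq_sum hne, divisorPoly_eq_sum hR, geomPoly, Finset.sum_mul_sum,
    ← Finset.sum_product']
  symm
  have hnd : ∀ u, u ∣ R → ¬ p ∣ u := fun u hu h => hpR (h.trans hu)
  apply Finset.sum_nbij (fun x => p ^ x.1 * x.2)
  · rintro ⟨i, u⟩ hx
    simp only [Finset.mem_product, Finset.mem_range, Set.Finite.mem_toFinset, monicDivisors,
      Set.mem_ofPred_eq] at hx ⊢
    exact ⟨(hp.pow _).mul hx.2.1, mul_dvd_mul (pow_dvd_pow _ (by omega)) hx.2.2⟩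
  · rintro ⟨i, u⟩ hx ⟨j, v⟩ hy hxy
    simp only [Finset.coe_product, Set.mem_prod, Finset.mem_coe, Finset.mem_range,
      Set.Finite.mem_toFinset, monicDivisors, Set.mem_ofPred_eq] at hx hy hxy
    have key : ∀ {i j : ℕ} {u v : F[X]}, ¬ p ∣ u → p ^ i * u = p ^ j * v → j ≤ i := by
      intro i j u v hu h
      by_contra! hlt
      obtain ⟨c, rfl⟩ := Nat.exists_eq_add_of_lt hlt
      apply hu
      have h' : p ^ i * u = p ^ i * (p * (p ^ c * v)) := by rw [h]; ring
      exact ⟨_, mul_left_cancel₀ (pow_ne_zero _ hp.ne_zero) h'⟩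
    have hij : i = j := le_antisymm (key (hnd v hy.2.2) hxy.symm) (key (hnd u hx.2.2) hxy)
    subst hij
    rw [mul_left_cancel₀ (pow_ne_zero _ hp.ne_zero) hxy]
  · intro w hw
    simp only [Set.Finite.coe_toFinset, monicDivisors, Set.mem_ofPred_eq] at hw
    obtain ⟨hwm, hwd⟩ := hw
    have hfin : FiniteMultiplicity p w :=
      FiniteMultiplicity.of_not_isUnit hirr.not_isUnit hwm.ne_zero
    obtain ⟨u, hu, hpu⟩ := hfin.exists_eq_pow_mul_and_not_dvd
    set i := multiplicity p w
    have hum : u.Monic := (hp.pow i).of_mul_monic_left (hu ▸ hwm)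
    have hcop : IsCoprime p u := (hirr.coprime_iff_not_dvd).2 hpu
    have hcopR : IsCoprime p R := (hirr.coprime_iff_not_dvd).2 hpR
    have huR : u ∣ R := by
      apply (hcop.symm.pow_right (n := r)).dvd_of_dvd_mul_left
      exact (Dvd.intro_left _ hu.symm).trans hwd
    have hir : i ≤ r := by
      have h1 : p ^ i ∣ p ^ r :=
        (hcopR.pow_left (m := i)).dvd_of_dvd_mul_right ((Dvd.intro _ hu.symm).trans hwd)
      exact (pow_dvd_pow_iff hp.ne_zero hirr.not_isUnit).1 h1
    refine ⟨(i, u), ?_, hu.symm⟩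
    simp only [Finset.coe_product, Set.mem_prod, Finset.mem_coe, Finset.mem_range,
      Set.Finite.mem_toFinset, monicDivisors, Set.mem_ofPred_eq]
    exact ⟨by omega, hum, huR⟩
  · rintro ⟨i, u⟩ hx
    simp only [Finset.mem_product, Finset.mem_range, Set.Finite.mem_toFinset, monicDivisors,
      Set.mem_ofPred_eq] at hx
    simp only
    rw [(hp.pow i).natDegree_mul hx.2.1, hp.natDegree_pow, pow_add, ← pow_mul, mul_comm i]

theorem coeff_divisorPoly_mul_pos {u s : F[X]} (hs : s ≠ 0) (hu : u.Monic) (hus : u ∣ s)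
    (Q : ℕ[X]) {m l : ℕ} (hm : m = u.natDegree + l) (hl : 0 < Q.coeff l) :
    0 < (divisorPoly s * Q).coeff m := by
  subst hm
  rw [divisorPoly_eq_sum hs, Finset.sum_mul, finsetSum_coeff]
  apply Finset.sum_pos' (fun _ _ => Nat.zero_le _)
  refine ⟨u, by simpa [monicDivisors] using ⟨hu, hus⟩, ?_⟩
  rwa [add_comm, coeff_X_pow_mul]

theorem coeff_geomPoly_one (m i : ℕ) : (geomPoly 1 m).coeff i = if i < m then 1 else 0 := by
  simp [geomPoly, coeff_X_pow]

theorem phiN_eq_coeff {n : ℕ} {s : F[X]} (hs : s.Monic) (hdeg : s.natDegree ≤ 2 * n) :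
    PhiN n s = (divisorPoly s * geomPoly 1 (2 * n - s.natDegree + 1)).coeff n := by
  classical
  have hcoeff : (divisorPoly s * geomPoly 1 (2 * n - s.natDegree + 1)).coeff n =
      ((monicDivisors_finite hs.ne_zero).toFinset.filter
        (fun u => u.natDegree ≤ n ∧ s.natDegree - u.natDegree ≤ n)).card := by
    rw [divisorPoly_eq_sum hs.ne_zero, Finset.sum_mul, finsetSum_coeff, Finset.card_filter]
    apply Finset.sum_congr rfl
    intro u hu
    have hle : u.natDegree ≤ s.natDegree := by
      simp only [Set.Finite.mem_toFinset, monicDivisors, Set.mem_ofPred_eq] at hu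
      exact natDegree_le_of_dvd hu.2 hs.ne_zero
    rw [coeff_X_pow_mul']
    simp only [coeff_geomPoly_one]
    split_ifs <;> first | rfl | omega
  rw [hcoeff, PhiN, ← Set.ncard_coe_finset]
  apply Set.ncard_congr (fun x _ => x.1)
  · rintro ⟨u, v⟩ ⟨h1, h2, h3, h4, h5⟩
    simp only at h1 h2 h3 h4 h5
    simp only [Finset.coe_filter, Set.Finite.mem_toFinset, monicDivisors, Set.mem_ofPred_eq]
    refine ⟨⟨h1, Dvd.intro _ h5.symm⟩, h2, ?_⟩
    rw [h5, h1.natDegree_mul h3]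
    omega
  · rintro ⟨u, v⟩ ⟨u', v'⟩ ⟨h1, h2, h3, h4, h5⟩ ⟨h1', h2', h3', h4', h5'⟩ h
    simp only at h h1 h5 h5'
    subst h
    rw [mul_left_cancel₀ h1.ne_zero (h5.symm.trans h5')]
  · intro u hu
    simp only [Finset.coe_filter, Set.Finite.mem_toFinset, monicDivisors, Set.mem_ofPred_eq] at hu
    obtain ⟨⟨hum, v, hv⟩, h1, h2⟩ := hu
    have hvm : v.Monic := hum.of_mul_monic_left (hv ▸ hs)
    rw [hv, hum.natDegree_mul hvm] at h2
    exact ⟨(u, v), ⟨hum, h1, hvm, by simp only; omega, hv⟩, rfl⟩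

/-- Exchanging a factor `p` for a pole at infinity of order `deg p` does not decrease `Φ_n` when
`p` contributes more to the degree of `s` than infinity does. -/
theorem phiN_le_of_mul_pow {n r : ℕ} {p R : F[X]} (hp : p.Monic) (hirr : Irreducible p)
    (hR : R.Monic) (hpR : ¬ p ∣ R) (hdeg : (p ^ (r + 1) * R).natDegree ≤ 2 * n)
    (h : 2 * n - (p ^ (r + 1) * R).natDegree + 1 ≤ (r + 1) * p.natDegree) :
    PhiN n (p ^ (r + 1) * R) ≤ PhiN n (p ^ r * R) := by
  have hd : (p ^ (r + 1) * R).natDegree = (p ^ r * R).natDegree + p.natDegree := by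
    rw [(hp.pow _).natDegree_mul hR, (hp.pow _).natDegree_mul hR, hp.natDegree_pow,
      hp.natDegree_pow]
    ring
  rw [phiN_eq_coeff ((hp.pow _).mul hR) hdeg, phiN_eq_coeff ((hp.pow _).mul hR) (by omega),
    divisorPoly_pow_mul hp hirr hR.ne_zero hpR, divisorPoly_pow_mul hp hirr hR.ne_zero hpR]
  have hk : 2 * n - (p ^ r * R).natDegree + 1 =
      2 * n - (p ^ (r + 1) * R).natDegree + 1 + p.natDegree := by omega
  rw [hk, mul_right_comm, mul_right_comm (geomPoly _ (r + 1)), geomPoly_exchange _ _ _ h, add_mul,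
    coeff_add]
  exact Nat.le_add_right _ _

/-- Exchanging a factor `p` for `deg p` copies of a linear factor increases `Φ_n`. -/
theorem phiN_lt_of_exchange_linear {n r e t : ℕ} {p l R : F[X]} (hp : p.Monic)
    (hirr : Irreducible p) (hl : l.Monic) (hl1 : l.natDegree = 1) (hlp : l ≠ p)
    (hR : R.Monic) (hpR : ¬ p ∣ R) (hlR : ¬ l ∣ R)
    (hdeg : (l ^ e * (p ^ (r + 1) * R)).natDegree ≤ 2 * n)
    (ht1 : e + 1 ≤ t) (ht2 : t < (r + 1) * p.natDegree) (htn : t ≤ n)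
    {u : F[X]} (hu : u.Monic) (huR : u ∣ R) (hun : u.natDegree ≤ n - t)
    (hun' : n - t ≤ u.natDegree + (2 * n - (l ^ e * (p ^ (r + 1) * R)).natDegree)) :
    PhiN n (l ^ e * (p ^ (r + 1) * R)) < PhiN n (l ^ (e + p.natDegree) * (p ^ r * R)) := by
  have hlirr := irreducible_of_monic_linear hl hl1
  have hlp' : ¬ l ∣ p := not_dvd_of_ne hl hlirr hp hirr hlp
  have hlpR : ∀ j, ¬ l ∣ p ^ j * R := fun j h =>
    (hlirr.prime.dvd_or_dvd h).elim (fun h => hlp' (hlirr.prime.dvd_of_dvd_pow h)) hlR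
  have hm : ∀ j, (p ^ j * R).Monic := fun j => (hp.pow j).mul hR
  have hd : (l ^ (e + p.natDegree) * (p ^ r * R)).natDegree =
      (l ^ e * (p ^ (r + 1) * R)).natDegree := by
    rw [(hl.pow _).natDegree_mul (hm _), (hl.pow _).natDegree_mul (hm _),
      (hp.pow _).natDegree_mul hR, (hp.pow _).natDegree_mul hR, hp.natDegree_pow,
      hp.natDegree_pow, hl.natDegree_pow, hl.natDegree_pow, hl1]
    ring
  rw [phiN_eq_coeff ((hl.pow _).mul (hm _)) hdeg,
    phiN_eq_coeff ((hl.pow _).mul (hm _)) (hd ▸ hdeg), hd,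
    divisorPoly_pow_mul hl hlirr (hm _).ne_zero (hlpR _),
    divisorPoly_pow_mul hl hlirr (hm _).ne_zero (hlpR _),
    divisorPoly_pow_mul hp hirr hR.ne_zero hpR, divisorPoly_pow_mul hp hirr hR.ne_zero hpR, hl1]
  set k := 2 * n - (l ^ e * (p ^ (r + 1) * R)).natDegree
  have hx := geomPoly_exchange p.natDegree (r + 1) e (by omega)
  have e1 : geomPoly 1 (e + p.natDegree + 1) * (geomPoly p.natDegree (r + 1) * divisorPoly R) *
      geomPoly 1 (k + 1) = (geomPoly p.natDegree (r + 1) * geomPoly 1 (e + 1 + p.natDegree)) *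
        (divisorPoly R * geomPoly 1 (k + 1)) := by
    rw [add_right_comm]; ring
  have e2 : geomPoly 1 (e + 1) * (geomPoly p.natDegree (r + 1 + 1) * divisorPoly R) *
      geomPoly 1 (k + 1) = (geomPoly p.natDegree (r + 1 + 1) * geomPoly 1 (e + 1)) *
        (divisorPoly R * geomPoly 1 (k + 1)) := by ring
  rw [e1, e2, hx, add_mul, coeff_add, Finset.sum_mul, finsetSum_coeff]
  refine Nat.lt_add_of_pos_right (Finset.sum_pos' (fun _ _ => Nat.zero_le _)
    ⟨t, Finset.mem_Ico.2 ⟨ht1, ht2⟩, ?_⟩)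
  rw [coeff_X_pow_mul', if_pos htn]
  refine coeff_divisorPoly_mul_pos hR.ne_zero hu huR _
    (l := n - t - u.natDegree) (by omega) ?_
  rw [coeff_geomPoly_one, if_pos (by omega)]
  exact one_pos

/-- Multiplying by a linear factor increases `Φ_n` when infinity has much larger multiplicity. -/
theorem phiN_lt_of_mul_linear {n e t : ℕ} {l R : F[X]} (hl : l.Monic) (hl1 : l.natDegree = 1)
    (hR : R.Monic) (hlR : ¬ l ∣ R) (hdeg : (l ^ e * R).natDegree ≤ 2 * n)
    (ht1 : e + 1 ≤ t) (ht2 : t < 2 * n - (l ^ e * R).natDegree) (htn : t ≤ n)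
    {u : F[X]} (hu : u.Monic) (huR : u ∣ R) (hun : u.natDegree = n - t) :
    PhiN n (l ^ e * R) < PhiN n (l ^ (e + 1) * R) := by
  have hlirr := irreducible_of_monic_linear hl hl1
  have hd : (l ^ (e + 1) * R).natDegree = (l ^ e * R).natDegree + 1 := by
    rw [(hl.pow _).natDegree_mul hR, (hl.pow _).natDegree_mul hR, hl.natDegree_pow,
      hl.natDegree_pow, hl1]
    ring
  rw [phiN_eq_coeff ((hl.pow _).mul hR) hdeg, phiN_eq_coeff ((hl.pow _).mul hR) (by omega),
    divisorPoly_pow_mul hl hlirr hR.ne_zero hlR, divisorPoly_pow_mul hl hlirr hR.ne_zero hlR, hl1]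
  set k := 2 * n - (l ^ e * R).natDegree
  have hk : 2 * n - (l ^ (e + 1) * R).natDegree + 1 = k := by omega
  have hx := geomPoly_exchange 1 k e (by omega)
  have e1 : geomPoly 1 (e + 1 + 1) * divisorPoly R * geomPoly 1 k =
      (geomPoly 1 k * geomPoly 1 (e + 1 + 1)) * divisorPoly R := by ring
  have e2 : geomPoly 1 (e + 1) * divisorPoly R * geomPoly 1 (k + 1) =
      (geomPoly 1 (k + 1) * geomPoly 1 (e + 1)) * divisorPoly R := by ring
  rw [hk, e1, e2, hx, add_mul, coeff_add, Finset.sum_mul, finsetSum_coeff]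
  refine Nat.lt_add_of_pos_right (Finset.sum_pos' (fun _ _ => Nat.zero_le _)
    ⟨t, Finset.mem_Ico.2 ⟨ht1, by omega⟩, ?_⟩)
  rw [coeff_X_pow_mul', if_pos htn]
  have := coeff_divisorPoly_mul_pos hR.ne_zero hu huR 1 (m := n - t) (l := 0) (by omega) (by simp)
  rwa [mul_one] at this

/-- If all irreducible factors have degree at most `c + 1`, then the degrees of the divisors leave
no gap of length more than `c`. -/
theorem exists_monic_divisor_natDegree_near (c : ℕ) (R : F[X]) (hR : R.Monic)
    (hc : ∀ p : F[X], p.Monic → Irreducible p → p ∣ R → p.natDegree ≤ c + 1)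
    (j : ℕ) (hj : j ≤ R.natDegree + c) :
    ∃ u : F[X], u.Monic ∧ u ∣ R ∧ u.natDegree ≤ j ∧ j ≤ u.natDegree + c := by
  induction hN : R.natDegree using Nat.strong_induction_on generalizing R with
  | _ N ih =>
  by_cases h : R.natDegree ≤ j
  · exact ⟨R, hR, dvd_rfl, h, hj⟩
  · have hnu : ¬ IsUnit R := fun hu => by
      rw [hR.isUnit_iff.1 hu] at h; simp at h
    obtain ⟨p, hp, hirr, S, rfl⟩ : ∃ p : F[X], p.Monic ∧ Irreducible p ∧ p ∣ R :=
      exists_monic_irreducible_factor R hnu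
    have hS : S.Monic := hp.of_mul_monic_left hR
    have hd := hp.natDegree_mul hS
    have hpos : 0 < p.natDegree := hirr.natDegree_pos
    have hpc := hc p hp hirr (dvd_mul_right _ _)
    obtain ⟨u, h1, h2, h3⟩ := ih S.natDegree (by omega) S hS
      (fun q hq hqi hqS => hc q hq hqi (hqS.mul_left p)) (by omega) rfl
    exact ⟨u, h1, h2.mul_left p, h3⟩

/-- If the multiplicity of a linear factor is large compared to the degrees of the
irreducible factors, then divisors of all degrees exist. -/
theorem exists_monic_divisor_natDegree_eq {c : ℕ} {l a : F[X]} (hl : l.Monic)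
    (hl1 : l.natDegree = 1) (ha : a.Monic) (hla : l ^ c ∣ a)
    (hc : ∀ p : F[X], p.Monic → Irreducible p → p ∣ a → p.natDegree ≤ c + 1)
    {j : ℕ} (hj : j ≤ a.natDegree) :
    ∃ u : F[X], u.Monic ∧ u ∣ a ∧ u.natDegree = j := by
  obtain ⟨R, rfl⟩ := hla
  have hR : R.Monic := (hl.pow c).of_mul_monic_left ha
  have hd := (hl.pow c).natDegree_mul hR
  rw [hl.natDegree_pow, hl1] at hd
  obtain ⟨u, h1, h2, h3, h4⟩ := exists_monic_divisor_natDegree_near c R hR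
    (fun q hq hqi hqS => hc q hq hqi (hqS.mul_left _)) j (by omega)
  refine ⟨l ^ (j - u.natDegree) * u, (hl.pow _).mul h1,
    mul_dvd_mul (pow_dvd_pow _ (by omega)) h2, ?_⟩
  rw [(hl.pow _).natDegree_mul h1, hl.natDegree_pow, hl1]
  omega

theorem exists_eq_pow_mul_not_dvd {p s : F[X]} (hp : p.Monic) (hirr : Irreducible p)
    (hs : s.Monic) : ∃ R : F[X], R.Monic ∧ ¬ p ∣ R ∧ s = p ^ multiplicity p s * R := by
  obtain ⟨R, h1, h2⟩ := (FiniteMultiplicity.of_not_isUnit hirr.not_isUnit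
    hs.ne_zero).exists_eq_pow_mul_and_not_dvd
  exact ⟨R, (hp.pow _).of_mul_monic_left (h1 ▸ hs), h2, h1⟩

theorem exists_linear_ne (p : F[X]) : ∃ l : F[X], l.Monic ∧ l.natDegree = 1 ∧ l ≠ p := by
  by_cases h : p = X
  · refine ⟨X - C 1, monic_X_sub_C 1, natDegree_X_sub_C 1, fun h' => ?_⟩
    rw [h, sub_eq_self] at h'
    simp at h'
  · exact ⟨X, monic_X, natDegree_X, Ne.symm h⟩

variable {n : ℕ} {s : F[X]}

/-- In an `n`-maximal `s` dominated by infinity, every linear multiplicity bounds all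
irreducible contributions to the degree. -/
theorem IsNMaximal.mul_natDegree_le_multiplicity_linear (hs : IsNMaximal n s)
    (hk : ∀ p : F[X], p.Monic → Irreducible p →
      multiplicity p s * p.natDegree ≤ 2 * n - s.natDegree)
    {p l : F[X]} (hp : p.Monic) (hirr : Irreducible p) (hl : l.Monic) (hl1 : l.natDegree = 1) :
    multiplicity p s * p.natDegree ≤ multiplicity l s + 1 := by
  by_contra! hlt
  obtain ⟨hsm, hsd, hmax⟩ := hs
  have hli := irreducible_of_monic_linear hl hl1
  have hlp : l ≠ p := by
    rintro rfl
    rw [hl1] at hlt; omega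
  obtain ⟨T, hT, hlT, hsT⟩ := exists_eq_pow_mul_not_dvd hl hli hsm
  have hkp := hk p hp hirr
  have hkall : ∀ q : F[X], q.Monic → Irreducible q → q ∣ s →
      q.natDegree ≤ 2 * n - s.natDegree + 1 := by
    intro q hq hqi hqs
    have h1 : 1 ≤ multiplicity q s := by
      have := (FiniteMultiplicity.of_not_isUnit hqi.not_isUnit
        hsm.ne_zero).pow_dvd_iff_le_multiplicity (k := 1)
      exact this.1 (by simpa using hqs)
    have := hk q hq hqi
    nlinarith
  obtain ⟨R, hR, hpR, hTR⟩ := exists_eq_pow_mul_not_dvd hp hirr hT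
  have hmul : multiplicity p T = multiplicity p s := by
    have hfs := FiniteMultiplicity.of_not_isUnit hirr.not_isUnit hsm.ne_zero
    have hfT := FiniteMultiplicity.of_not_isUnit hirr.not_isUnit hT.ne_zero
    have hpl : ¬ p ∣ l := not_dvd_of_ne hp hirr hl hli hlp.symm
    apply le_antisymm
    · rw [← hfs.pow_dvd_iff_le_multiplicity]
      exact (pow_multiplicity_dvd p T).trans (Dvd.intro_left _ hsT.symm)
    · rw [← hfT.pow_dvd_iff_le_multiplicity]
      have hc : IsCoprime (p ^ multiplicity p s) (l ^ multiplicity l s) :=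
        ((hirr.coprime_iff_not_dvd).2 hpl).pow
      apply hc.dvd_of_dvd_mul_left
      rw [← hsT]
      exact pow_multiplicity_dvd p s
  rw [hmul] at hTR
  set e := multiplicity l s
  obtain ⟨r, hr⟩ : ∃ r, multiplicity p s = r + 1 :=
    Nat.exists_eq_succ_of_ne_zero (by intro h; rw [h] at hlt; omega)
  rw [hr] at hTR hlt hkp
  have hlR : ¬ l ∣ R := fun h => hlT (hTR ▸ h.mul_left _)
  rw [hTR] at hsT
  have hd : s.natDegree = e + ((r + 1) * p.natDegree + R.natDegree) := by
    rw [hsT, (hl.pow _).natDegree_mul ((hp.pow _).mul hR), (hp.pow _).natDegree_mul hR,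
      hl.natDegree_pow, hp.natDegree_pow, hl1, mul_one]
  obtain ⟨u, hu, huR, hu1, hu2⟩ := exists_monic_divisor_natDegree_near
    (2 * n - s.natDegree) R hR
    (fun q hq hqi hqR => hkall q hq hqi (hsT ▸ (hqR.mul_left _).mul_left _))
    (n - (e + 1)) (by omega)
  have hlt' : PhiN n s < PhiN n (l ^ (e + p.natDegree) * (p ^ r * R)) := by
    conv_lhs => rw [hsT]
    exact phiN_lt_of_exchange_linear hp hirr hl hl1 hlp hR hpR hlR (hsT ▸ hsd)
      (le_refl (e + 1)) (by omega) (by omega) hu huR hu1 (hsT ▸ hu2)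
  refine absurd (hmax _ ((hl.pow _).mul ((hp.pow _).mul hR)) ?_) (not_le.2 hlt')
  rw [(hl.pow _).natDegree_mul ((hp.pow _).mul hR), (hp.pow _).natDegree_mul hR,
      hl.natDegree_pow, hp.natDegree_pow, hl1, mul_one]
  linarith

/-- In an `n`-maximal `s` dominated by infinity, the cofactor of a full irreducible power has
divisors of all degrees. -/
theorem IsNMaximal.exists_divisor_cofactor (hs : IsNMaximal n s)
    (hk : ∀ p : F[X], p.Monic → Irreducible p →
      multiplicity p s * p.natDegree ≤ 2 * n - s.natDegree)
    {p a : F[X]} (hp : p.Monic) (hirr : Irreducible p) {r : ℕ} (hsa : s = p ^ r * a)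
    {j : ℕ} (hj : j ≤ a.natDegree) : ∃ u : F[X], u.Monic ∧ u ∣ a ∧ u.natDegree = j := by
  obtain ⟨l, hl, hl1, hlp⟩ := exists_linear_ne p
  have hsm := hs.1
  have hli := irreducible_of_monic_linear hl hl1
  have ham : a.Monic := (hp.pow r).of_mul_monic_left (hsa ▸ hsm)
  refine exists_monic_divisor_natDegree_eq (c := multiplicity l s) hl hl1 ham ?_ ?_ hj
  · have hc : IsCoprime (l ^ multiplicity l s) (p ^ r) :=
      ((hli.coprime_iff_not_dvd).2 (not_dvd_of_ne hl hli hp hirr hlp)).pow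
    apply hc.dvd_of_dvd_mul_left
    rw [← hsa]
    exact pow_multiplicity_dvd l s
  · intro q hq hqi hqa
    have h1 : 1 ≤ multiplicity q s := by
      have := (FiniteMultiplicity.of_not_isUnit hqi.not_isUnit
        hsm.ne_zero).pow_dvd_iff_le_multiplicity (k := 1)
      exact this.1 (by simpa using hsa ▸ hqa.mul_left _)
    have := hs.mul_natDegree_le_multiplicity_linear hk hq hqi hl hl1
    nlinarith

/-- In an `n`-maximal `s` dominated by infinity, linear multiplicities nearly reach the
multiplicity at infinity. -/
theorem IsNMaximal.le_multiplicity_linear (hs : IsNMaximal n s)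
    (hk : ∀ p : F[X], p.Monic → Irreducible p →
      multiplicity p s * p.natDegree ≤ 2 * n - s.natDegree)
    {l : F[X]} (hl : l.Monic) (hl1 : l.natDegree = 1) :
    2 * n - s.natDegree ≤ multiplicity l s + 1 := by
  by_contra! hlt
  have hli := irreducible_of_monic_linear hl hl1
  obtain ⟨R, hR, hlR, hsR⟩ := exists_eq_pow_mul_not_dvd hl hli hs.1
  set e := multiplicity l s
  have hsd := hs.2.1
  have hd : s.natDegree = e + R.natDegree := by
    rw [hsR, (hl.pow _).natDegree_mul hR, hl.natDegree_pow, hl1, mul_one]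
  obtain ⟨u, hu, huR, hun⟩ := hs.exists_divisor_cofactor hk hl hli hsR
    (j := n - (2 * n - s.natDegree + e) / 2) (by omega)
  have hlt' : PhiN n s < PhiN n (l ^ (e + 1) * R) := by
    conv_lhs => rw [hsR]
    exact phiN_lt_of_mul_linear (t := (2 * n - s.natDegree + e) / 2) hl hl1 hR hlR (hsR ▸ hsd)
      (by omega) (by rw [← hsR]; omega) (by omega) hu huR hun
  refine absurd (hs.2.2 _ ((hl.pow _).mul hR) ?_) (not_le.2 hlt')
  rw [(hl.pow _).natDegree_mul hR, hl.natDegree_pow, hl1, mul_one]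
  omega

/-- If infinity dominates all linear factors of an `n`-maximal `s`, it dominates all
irreducible factors. -/
theorem IsNMaximal.mul_natDegree_le (hs : IsNMaximal n s)
    (hlin : ∀ l : F[X], l.Monic → l.natDegree = 1 → multiplicity l s ≤ 2 * n - s.natDegree)
    (p : F[X]) (hp : p.Monic) (hirr : Irreducible p) :
    multiplicity p s * p.natDegree ≤ 2 * n - s.natDegree := by
  induction hN : s.natDegree using Nat.strong_induction_on generalizing s p with
  | _ N ih =>
  subst hN
  by_contra! hlt
  obtain ⟨hsm, hsd, hmax⟩ := hs
  obtain ⟨R, hR, hpR, hsR⟩ := exists_eq_pow_mul_not_dvd hp hirr hsm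
  have hd1 : p.natDegree ≠ 1 := fun h => by
    have := hlin p hp h
    rw [h] at hlt; omega
  have hd0 : 0 < p.natDegree := hirr.natDegree_pos
  obtain ⟨r, hr⟩ : ∃ r, multiplicity p s = r + 1 :=
    Nat.exists_eq_succ_of_ne_zero (by intro h; rw [h] at hlt; omega)
  rw [hr] at hsR hlt
  have htm : (p ^ r * R).Monic := (hp.pow _).mul hR
  have hst : s = p * (p ^ r * R) := by rw [hsR]; ring
  have hd : s.natDegree = p.natDegree + (p ^ r * R).natDegree := by
    conv_lhs => rw [hst]
    exact hp.natDegree_mul htm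
  have hle : PhiN n s ≤ PhiN n (p ^ r * R) := by
    conv_lhs => rw [hsR]
    exact phiN_le_of_mul_pow hp hirr hR hpR (hsR ▸ hsd) (by rw [← hsR]; omega)
  have ht : IsNMaximal n (p ^ r * R) :=
    ⟨htm, by omega, fun t h1 h2 => (hmax t h1 h2).trans hle⟩
  have hmul : ∀ l : F[X], l.Monic → l.natDegree = 1 →
      multiplicity l (p ^ r * R) ≤ 2 * n - s.natDegree := by
    intro l hl hl1
    refine le_trans ?_ (hlin l hl hl1)
    rw [← (FiniteMultiplicity.of_not_isUnit (irreducible_of_monic_linear hl hl1).not_isUnit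
        hsm.ne_zero).pow_dvd_iff_le_multiplicity]
    exact (pow_multiplicity_dvd l _).trans (Dvd.intro_left _ hst.symm)
  have hgood := fun q hq hqi => ih _ (by omega) ht
    (fun l hl hl1 => (hmul l hl hl1).trans (by omega)) q hq hqi rfl
  have h1 := ht.le_multiplicity_linear hgood monic_X natDegree_X
  have h2 := hmul X monic_X natDegree_X
  omega

theorem multiplicity_le_rho (hs : s.Monic) {l : F[X]} (hl : l.Monic) (hl1 : l.natDegree = 1) :
    multiplicity l s ≤ rho s := by
  refine le_csSup ⟨s.natDegree, ?_⟩ ⟨l, hl, hl1, rfl⟩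
  rintro _ ⟨p, hp, hp1, rfl⟩
  have := natDegree_le_of_dvd (pow_multiplicity_dvd p s) hs.ne_zero
  rwa [hp.natDegree_pow, hp1, mul_one] at this

end

/-- Lemma: let `s ∈ P_{2n}` be `n`-maximal with `ρ_n(s) = 2n − deg s`, let `p` be a monic
irreducible polynomial of degree `d`, `r = mult_p(s)`, and `h = (2n − deg s) + r·d`. Then
`a = s / p^r` has a monic divisor of degree exactly `n − ⌊h/2⌋`. -/
theorem nMaximal_exists_divisor_half {F : Type} [Field F] [Fintype F]
    (n : ℕ) (hn : 0 < n) (s : F[X]) (hs : IsNMaximal n s)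
    (hrho : rhoN n s = 2 * n - s.natDegree)
    (p : F[X]) (hp : p.Monic) (hpirr : Irreducible p) :
    ∃ f : F[X], f.Monic ∧ f ∣ s / p ^ multiplicity p s ∧
      f.natDegree =
        n - ((2 * n - s.natDegree) + multiplicity p s * p.natDegree) / 2 := by
  have hlin : ∀ l : F[X], l.Monic → l.natDegree = 1 →
      multiplicity l s ≤ 2 * n - s.natDegree := fun l hl hl1 =>
    (multiplicity_le_rho hs.1 hl hl1).trans ((le_max_right _ _).trans hrho.le)
  obtain ⟨a, ha, hpa, hsa⟩ := exists_eq_pow_mul_not_dvd hp hpirr hs.1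
  have hquot : s / p ^ multiplicity p s = a :=
    EuclideanDomain.eq_div_of_mul_eq_right (pow_ne_zero _ hp.ne_zero) hsa.symm |>.symm
  have hd : s.natDegree = multiplicity p s * p.natDegree + a.natDegree := by
    conv_lhs => rw [hsa]
    rw [(hp.pow _).natDegree_mul ha, hp.natDegree_pow]
  have hsd := hs.2.1
  rw [hquot]
  exact hs.exists_divisor_cofactor (hs.mul_natDegree_le hlin) hp hpirr hsa (by omega)
end

section
/- Let d and r₀ be positive integers and r a nonnegative integer, and set h = r₀ + r·d. For nonnegative integers ρ₀, ρ and an integer k, let N(ρ₀, ρ; k) denote the number of pairs of integers (w₀, w) with 0 ≤ w₀ ≤ ρ₀, 0 ≤ w ≤ ρ, and w₀ + w·d = k. Then: (a) if r₀ + 1 > (r + 2)·d, then N(r₀, r; k) ≤ N(r₀ − d, r + 1; k) for every integer k ∈ [0, h], and moreover N(r₀, r; ⌊h/2⌋) < N(r₀ − d, r + 1; ⌊h/2⌋); (b) if r ≥ 1 and r₀ + 1 ≤ r·d, then N(r₀, r; k) ≤ N(r₀ + d, r − 1; k) for every integer k ∈ [0, h], and if moreover r₀ + 1 < r·d then N(r₀,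 r; ⌊h/2⌋) < N(r₀ + d, r − 1; ⌊h/2⌋). -/
/-- `N(ρ₀, ρ; k)` (for the fixed step `d`): the number of pairs of integers `(w₀, w)` with
`0 ≤ w₀ ≤ ρ₀`, `0 ≤ w ≤ ρ` and `w₀ + w·d = k`. -/
def latticeCount (d ρ₀ ρ k : ℕ) : ℕ :=
  (((Finset.range (ρ₀ + 1)) ×ˢ (Finset.range (ρ + 1))).filter
    (fun w => w.1 + w.2 * d = k)).card

/-- The second coordinates of the lattice points `(w₀, w)` in `[0, a] × [0, b]` with
`w₀ + w * d = k`; they determine the points. -/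
def latticeFibre (d a b k : ℕ) : Finset ℕ :=
  (Finset.range (b + 1)).filter fun w => w * d ≤ k ∧ k ≤ a + w * d

theorem mem_latticeFibre {d a b k w : ℕ} :
    w ∈ latticeFibre d a b k ↔ w ≤ b ∧ w * d ≤ k ∧ k ≤ a + w * d := by
  simp [latticeFibre]

theorem latticeCount_eq_card_latticeFibre (d a b k : ℕ) :
    latticeCount d a b k = (latticeFibre d a b k).card := by
  refine Finset.card_bij (fun w _ => w.2) ?_ ?_ ?_
  · rintro ⟨x, y⟩ h
    simp only [Finset.mem_filter, Finset.mem_product, Finset.mem_range] at h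
    rw [mem_latticeFibre]
    dsimp only
    omega
  · rintro ⟨x, y⟩ h ⟨x', y'⟩ h' hy
    simp only [Finset.mem_filter, Finset.mem_product, Finset.mem_range] at h h' hy
    subst hy
    rw [Prod.mk.injEq]
    omega
  · intro w hw
    rw [mem_latticeFibre] at hw
    refine ⟨(k - w * d, w), ?_, rfl⟩
    simp only [Finset.mem_filter, Finset.mem_product, Finset.mem_range]
    omega

theorem latticeFibre_subset_of_le_sub {d a b k : ℕ} (hk : k ≤ a - d) :
    latticeFibre d a b k ⊆ latticeFibre d (a - d) (b + 1) k := by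
  intro w hw
  rw [mem_latticeFibre] at hw ⊢
  omega

theorem latticeFibre_subset_of_lt_mul {d a b k : ℕ} (hk : k < b * d) :
    latticeFibre d a b k ⊆ latticeFibre d (a + d) (b - 1) k := by
  intro w hw
  rw [mem_latticeFibre] at hw ⊢
  have : w < b := Nat.lt_of_mul_lt_mul_right (hw.2.1.trans_lt hk)
  omega

theorem card_latticeFibre_le_of_mul_le {d a b k : ℕ} (hk : (b + 1) * d ≤ k) (hda : d ≤ a) :
    (latticeFibre d a b k).card ≤ (latticeFibre d (a - d) (b + 1) k).card := by
  refine Finset.card_le_card_of_injOn (· + 1) ?_ (by intro x _ y _ h; simpa using h)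
  intro w hw
  rw [Finset.mem_coe, mem_latticeFibre] at hw ⊢
  have := Nat.mul_le_mul_right d hw.1
  rw [add_one_mul] at hk
  dsimp only
  rw [add_one_mul]
  omega

theorem card_latticeFibre_le_of_lt {d a b k : ℕ} (hk : a < k) :
    (latticeFibre d a b k).card ≤ (latticeFibre d (a + d) (b - 1) k).card := by
  have pos : ∀ w ∈ latticeFibre d a b k, 0 < w := by
    intro w hw
    rw [mem_latticeFibre] at hw
    rcases Nat.eq_zero_or_pos w with rfl | h <;> omega
  refine Finset.card_le_card_of_injOn (· - 1) ?_ ?_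
  · intro w hw
    obtain ⟨v, rfl⟩ := Nat.exists_eq_add_of_lt (pos w hw)
    rw [Finset.mem_coe, mem_latticeFibre] at hw ⊢
    simp only [zero_add, add_one_mul, Nat.add_sub_cancel] at hw ⊢
    omega
  · intro x hx y hy h
    have := pos x hx
    have := pos y hy
    dsimp only at h
    omega

/-- Lemmas (cases A and B): let `d, r₀` be positive integers, `r ≥ 0`, and
`h = r₀ + r·d`.
(a) If `r₀ + 1 > (r + 2)·d` then `N(r₀, r; k) ≤ N(r₀ − d, r + 1; k)` for every
`k ∈ [0, h]`, and `N(r₀, r; ⌊h/2⌋) < N(r₀ − d, r + 1; ⌊h/2⌋)`.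
(b) If `r ≥ 1` and `r₀ + 1 ≤ r·d` then `N(r₀, r; k) ≤ N(r₀ + d, r − 1; k)` for every
`k ∈ [0, h]`, and if moreover `r₀ + 1 < r·d` then
`N(r₀, r; ⌊h/2⌋) < N(r₀ + d, r − 1; ⌊h/2⌋)`. -/
theorem latticeCount_compare (d r₀ r : ℕ) (hd : 0 < d) (hr₀ : 0 < r₀) :
    (((r + 2) * d < r₀ + 1 →
      (∀ k : ℕ, k ≤ r₀ + r * d →
        latticeCount d r₀ r k ≤ latticeCount d (r₀ - d) (r + 1) k) ∧
      latticeCount d r₀ r ((r₀ + r * d) / 2) <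
        latticeCount d (r₀ - d) (r + 1) ((r₀ + r * d) / 2))) ∧
    (1 ≤ r → r₀ + 1 ≤ r * d →
      (∀ k : ℕ, k ≤ r₀ + r * d →
        latticeCount d r₀ r k ≤ latticeCount d (r₀ + d) (r - 1) k) ∧
      (r₀ + 1 < r * d →
        latticeCount d r₀ r ((r₀ + r * d) / 2) <
          latticeCount d (r₀ + d) (r - 1) ((r₀ + r * d) / 2))) := by
  simp only [latticeCount_eq_card_latticeFibre]
  refine ⟨fun h => ?_, fun hr h => ?_⟩
  · have e₁ : (r + 1) * d = r * d + d := by ring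
    have e₂ : (r + 2) * d = r * d + 2 * d := by ring
    refine ⟨fun k _ => ?_, ?_⟩
    · rcases le_or_gt k (r₀ - d) with hk | hk
      · exact Finset.card_le_card (latticeFibre_subset_of_le_sub hk)
      · exact card_latticeFibre_le_of_mul_le (by omega) (by omega)
    · refine Finset.card_lt_card (Finset.ssubset_iff_of_subset
        (latticeFibre_subset_of_le_sub (by omega)) |>.2 ⟨r + 1, ?_, ?_⟩)
      · rw [mem_latticeFibre]
        omega
      · rw [mem_latticeFibre]
        omega
  · refine ⟨fun k _ => ?_, fun h' => ?_⟩
    · rcases lt_or_ge k (r * d) with hk | hk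
      · exact Finset.card_le_card (latticeFibre_subset_of_lt_mul hk)
      · exact card_latticeFibre_le_of_lt (by omega)
    · set k := (r₀ + r * d) / 2 with hk
      have hlt : k < r * d := by omega
      have hdiv := Nat.div_add_mod' (k - r₀ - 1) d
      have hmod := Nat.mod_lt (k - r₀ - 1) hd
      refine Finset.card_lt_card (Finset.ssubset_iff_of_subset
        (latticeFibre_subset_of_lt_mul hlt) |>.2 ⟨(k - r₀ - 1) / d, ?_, ?_⟩)
      · have : (k - r₀ - 1) / d < r := Nat.div_lt_of_lt_mul (by rw [mul_comm]; omega)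
        rw [mem_latticeFibre]
        omega
      · rw [mem_latticeFibre]
        omega
end
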